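/- Suppose triangle ABC is N-tiled by a tile with angles (α, β, 2π/3) that is not similar to ABC, and α is not a rational multiple of π. Then N ≥ 12; in particular N is not 7 and not 11. -/

import Mathlib

open EuclideanGeometry Real

noncomputable section

/-- A point of the Euclidean plane. -/
abbrev Pt : Type := EuclideanSpace ℝ (Fin 2)

/-- A triangle, given by its three vertices. -/
abbrev Tri : Type := Fin 3 → Pt

/-- A genuine (nondegenerate) triangle. -/
def IsTriangle (T : Tri) : Prop := AffineIndependent ℝ T

/-- The closed triangle (convex hull of the vertices). -/
def triSet (T : Tri) : Set Pt := convexHull ℝ (Set.range T)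

/-- Two triangles are congruent iff corresponding distances agree
up to a permutation of the vertices. -/
def CongruentTri (T₁ T₂ : Tri) : Prop :=
  ∃ σ : Equiv.Perm (Fin 3), ∀ i j : Fin 3, dist (T₁ i) (T₁ j) = dist (T₂ (σ i)) (T₂ (σ j))

/-- An `N`-tiling of the triangle `ABC` by the tile `T`: a family of `N` triangles,
each congruent to `T`, with pairwise disjoint interiors, whose union is the
closed triangle `ABC`. -/
structure IsTiling (N : ℕ) (ABC T : Tri) (tiles : Fin N → Tri) : Prop where
  congr : ∀ i, CongruentTri (tiles i) T
  disj : ∀ i j, i ≠ j → interior (triSet (tiles i)) ∩ interior (triSet (tiles j)) = ∅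
  cover : (⋃ i, triSet (tiles i)) = triSet ABC

/-- The interior angle of the triangle `T` at its `k`-th vertex. -/
def triAngle (T : Tri) (k : Fin 3) : ℝ := ∠ (T (k + 1)) (T k) (T (k + 2))

/-- The side of `T` opposite to the `k`-th vertex. -/
def sideLen (T : Tri) (k : Fin 3) : ℝ := dist (T (k + 1)) (T (k + 2))

/-- `T` has angles `α`, `β`, `γ` (at vertices `0`, `1`, `2`, which are opposite
the sides of lengths `a`, `b`, `c` respectively). -/
def HasAngles (T : Tri) (α β γ : ℝ) : Prop :=
  triAngle T 0 = α ∧ triAngle T 1 = β ∧ triAngle T 2 = γ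

/-- Two triangles are similar iff corresponding distances agree up to a
permutation of the vertices and a positive scale factor. -/
def SimilarTri (T₁ T₂ : Tri) : Prop :=
  ∃ r : ℝ, 0 < r ∧ ∃ σ : Equiv.Perm (Fin 3),
    ∀ i j : Fin 3, dist (T₁ i) (T₁ j) = r * dist (T₂ (σ i)) (T₂ (σ j))

section
namespace TT

/-- cross product -/
def cr (z w : ℂ) : ℝ := z.re * w.im - z.im * w.re

abbrev Trc : Type := Fin 3 → ℂ

def dt (t : Trc) : ℝ := cr (t 1 - t 0) (t 2 - t 0)

def ed (t : Trc) (i : Fin 3) : ℂ := t (i + 2) - t (i + 1)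

def bc (t : Trc) (i : Fin 3) (x : ℂ) : ℝ := cr (ed t i) (x - t (i + 1)) / dt t

def hull (t : Trc) : Set ℂ := convexHull ℝ (Set.range t)

lemma fin3_cas : ∀ i j : Fin 3, j = i ∨ j = i + 1 ∨ j = i + 2 := by decide

lemma bc_line (t : Trc) (i : Fin 3) (x w : ℂ) (s : ℝ) :
    bc t i (x + s * w) = bc t i x + s * (cr (ed t i) w / dt t) := by
  simp [bc, cr, ed]; ring

lemma bc_comb (t : Trc) (i : Fin 3) (x y : ℂ) (s r : ℝ) (h : s + r = 1) :
    bc t i (s • x + r • y) = s * bc t i x + r * bc t i y := by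
  obtain rfl : r = 1 - s := by linarith
  simp [bc, cr, ed]; ring

lemma bc_self (t : Trc) (h : dt t ≠ 0) (i : Fin 3) : bc t i (t i) = 1 := by
  rw [bc, div_eq_one_iff_eq h]
  fin_cases i <;> simp [cr, ed, dt] <;> ring

lemma bc_succ (t : Trc) (i : Fin 3) : bc t i (t (i + 1)) = 0 := by
  simp [bc, cr]

lemma bc_succ2 (t : Trc) (i : Fin 3) : bc t i (t (i + 2)) = 0 := by
  simp [bc, cr, ed]; left; ring

lemma bc_sum (t : Trc) (h : dt t ≠ 0) (x : ℂ) : bc t 0 x + bc t 1 x + bc t 2 x = 1 := by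
  simp only [bc]
  rw [← add_div, ← add_div, div_eq_one_iff_eq h]
  simp [cr, ed, dt]; ring

lemma bc_rep (t : Trc) (h : dt t ≠ 0) (x : ℂ) :
    x = bc t 0 x • t 0 + bc t 1 x • t 1 + bc t 2 x • t 2 := by
  have h' := h
  simp only [dt, cr, Complex.sub_re, Complex.sub_im] at h'
  apply Complex.ext <;>
  · simp only [bc, Complex.add_re, Complex.add_im, Complex.smul_re, Complex.smul_im, smul_eq_mul, cr, ed, dt, Complex.sub_re, Complex.sub_im]
    simp
    field_simp
    ring

lemma bc_cont (t : Trc) (i : Fin 3) : Continuous (bc t i) := by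
  unfold bc cr; fun_prop

lemma hull_eq (t : Trc) (h : dt t ≠ 0) : hull t = {x | ∀ i, 0 ≤ bc t i x} := by
  apply Set.Subset.antisymm
  · apply convexHull_min
    · rintro _ ⟨j, rfl⟩ i
      have := fin3_cas i j
      rcases this with rfl | rfl | rfl
      · rw [bc_self t h]; norm_num
      · rw [bc_succ]
      · rw [bc_succ2]
    · intro x hx y hy s r hs hr hsr i
      rw [bc_comb _ _ _ _ _ _ hsr]
      have := hx i; have := hy i
      positivity
  · intro x hx
    rw [bc_rep t h x]
    have hc := convex_convexHull ℝ (Set.range t)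
    have hm : ∀ i, t i ∈ convexHull ℝ (Set.range t) := fun i => subset_convexHull _ _ ⟨i, rfl⟩
    have := hc.sum_mem (t := Finset.univ) (w := fun i => bc t i x) (z := t) (fun i _ => hx i)
      (by simp [Fin.sum_univ_three, bc_sum t h x]) (fun i _ => hm i)
    simpa [hull, Fin.sum_univ_three] using this

lemma hull_closed (t : Trc) (h : dt t ≠ 0) : IsClosed (hull t) := by
  rw [hull_eq t h]
  simp only [Set.ofPred_forall]
  exact isClosed_iInter fun i => isClosed_le continuous_const (bc_cont t i)

lemma interior_hull (t : Trc) (h : dt t ≠ 0) : interior (hull t) = {x | ∀ i, 0 < bc t i x} := by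
  apply Set.Subset.antisymm
  · intro x hx i
    have h1 : ∀ᶠ y in nhds x, y ∈ hull t := mem_interior_iff_mem_nhds.1 hx
    have h0 : 0 ≤ bc t i x := by
      have := interior_subset hx
      rw [hull_eq t h] at this
      exact this i
    rcases h0.lt_or_eq with h0 | h0
    · exact h0
    exfalso
    have hc : Filter.Tendsto (fun s : ℝ => x + s * (x - t i)) (nhds 0) (nhds x) := by
      have : Continuous (fun s : ℝ => x + s * (x - t i)) := by fun_prop
      simpa using this.tendsto 0
    have h2 := (hc.eventually h1)
    obtain ⟨e, he, h3⟩ := Metric.eventually_nhds_iff.1 h2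
    have h4 := h3 (y := e/2) (by simp [abs_of_pos he]; linarith)
    rw [hull_eq t h] at h4
    have h5 := h4 i
    have h6 : x + ((e/2 : ℝ) : ℂ) * (x - t i) = (1 + e/2) • x + (-(e/2)) • t i := by
      simp; ring
    rw [h6, bc_comb _ _ _ _ _ _ (by ring), bc_self t h, ← h0] at h5
    linarith
  · apply interior_maximal
    · rw [hull_eq t h]; intro x hx i; exact (hx i).le
    · simp only [Set.ofPred_forall]
      exact isOpen_iInter_of_finite fun i => isOpen_lt continuous_const (bc_cont t i)

/-- open edge -/
def oe (t : Trc) (i : Fin 3) : Set ℂ := {x | bc t i x = 0 ∧ 0 < bc t (i+1) x ∧ 0 < bc t (i+2) x}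

lemma hull_cases (t : Trc) (h : dt t ≠ 0) {x : ℂ} (hx : x ∈ hull t) (hv : ∀ i, x ≠ t i) :
    x ∈ interior (hull t) ∨ ∃ i, x ∈ oe t i := by
  rw [interior_hull t h]
  rw [hull_eq t h] at hx
  by_contra hcon
  push Not at hcon
  obtain ⟨hc1, hc2⟩ := hcon
  simp only [Set.mem_ofPred_eq, not_forall, not_lt] at hc1
  obtain ⟨i, hi⟩ := hc1
  have hi0 : bc t i x = 0 := le_antisymm hi (hx i)
  have h3 := hc2 i
  have hs := bc_sum t h x
  have hr := bc_rep t h x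
  have key : bc t (i+1) x = 0 ∨ bc t (i+2) x = 0 := by
    by_contra hk
    push Not at hk
    exact h3 ⟨hi0, lt_of_le_of_ne (hx _) (Ne.symm hk.1), lt_of_le_of_ne (hx _) (Ne.symm hk.2)⟩
  have : ∃ j, bc t j x = 1 ∧ bc t (j+1) x = 0 ∧ bc t (j+2) x = 0 := by
    fin_cases i <;> rcases key with k | k <;> simp at hi0 k
    · exact ⟨2, by rw [hi0, k] at hs; linarith, by simpa using hi0, by simpa using k⟩
    · exact ⟨1, by rw [hi0, k] at hs; linarith, by simpa using k, by simpa using hi0⟩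
    · exact ⟨0, by rw [hi0, k] at hs; linarith, by simpa using hi0, by simpa using k⟩
    · exact ⟨2, by rw [hi0, k] at hs; linarith, by simpa using k, by simpa using hi0⟩
    · exact ⟨1, by rw [hi0, k] at hs; linarith, by simpa using hi0, by simpa using k⟩
    · exact ⟨0, by rw [hi0, k] at hs; linarith, by simpa using k, by simpa using hi0⟩
  obtain ⟨j, h1, h2, h4⟩ := this
  apply hv j
  rw [hr]
  fin_cases j <;> simp at h1 h2 h4 <;> simp [h1, h2, h4]

lemma oe_sub (t : Trc) (h : dt t ≠ 0) (i : Fin 3) : oe t i ⊆ hull t := by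
  rw [hull_eq t h]
  rintro x ⟨h1, h2, h3⟩ j
  have := fin3_cas i j
  rcases this with rfl | rfl | rfl
  · exact h1.ge
  · exact h2.le
  · exact h3.le

lemma oe_not_int (t : Trc) (h : dt t ≠ 0) (i : Fin 3) {x : ℂ} (hx : x ∈ oe t i) :
    x ∉ interior (hull t) := by
  rw [interior_hull t h]
  intro hc
  exact absurd hx.1 (hc i).ne'

lemma oe_unique (t : Trc) {i j : Fin 3} {x : ℂ} (hi : x ∈ oe t i) (hj : x ∈ oe t j) : i = j := by
  have := fin3_cas i j
  rcases this with rfl | rfl | rfl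
  · rfl
  · exact absurd hj.1 hi.2.1.ne'
  · exact absurd hj.1 hi.2.2.ne'

lemma oe_eq (t : Trc) (h : dt t ≠ 0) (i : Fin 3) :
    oe t i = openSegment ℝ (t (i+1)) (t (i+2)) := by
  ext x
  constructor
  · rintro ⟨h1, h2, h3⟩
    refine ⟨bc t (i+1) x, bc t (i+2) x, h2, h3, ?_, ?_⟩
    · have := bc_sum t h x
      fin_cases i <;> simp at h1 ⊢ <;> linarith
    · have := bc_rep t h x
      conv_rhs => rw [this]
      fin_cases i <;> simp at h1 ⊢ <;> simp [h1] <;> ring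
  · rintro ⟨s, r, hs, hr, hsr, rfl⟩
    have e1 : bc t (i+1) (t (i+2)) = 0 := by
      have := bc_succ t (i+1); rwa [add_assoc] at this
    have e2 : bc t (i+2) (t (i+1)) = 0 := by
      have := bc_succ2 t (i+2); rwa [add_assoc, show (2:Fin 3)+2 = 1 by decide] at this
    refine ⟨?_, ?_, ?_⟩
    · rw [bc_comb _ _ _ _ _ _ hsr, bc_succ, bc_succ2]; simp
    · rw [bc_comb _ _ _ _ _ _ hsr, bc_self t h, e1]; simpa
    · rw [bc_comb _ _ _ _ _ _ hsr, bc_self t h, e2]; simpa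

/-- ccw direction of the edge -/
def dir (t : Trc) (i : Fin 3) : ℂ := (SignType.sign (dt t) : ℝ) * ed t i

lemma cr_dir (t : Trc) (h : dt t ≠ 0) (i : Fin 3) (w : ℂ) :
    ∃ k > 0, cr (ed t i) w / dt t = k * cr (dir t i) w := by
  rcases lt_or_gt_of_ne h with h1 | h1
  · refine ⟨-(dt t)⁻¹, by simpa using h1, ?_⟩
    simp [dir, sign_neg h1, cr]; field_simp; ring
  · refine ⟨(dt t)⁻¹, by simpa using h1, ?_⟩
    simp [dir, sign_pos h1, cr]; field_simp

lemma ed_ne (t : Trc) (h : dt t ≠ 0) (i : Fin 3) : ed t i ≠ 0 := by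
  intro hc
  have := bc_self t h i
  rw [bc, hc] at this
  simp [cr] at this

lemma dir_ne (t : Trc) (h : dt t ≠ 0) (i : Fin 3) : dir t i ≠ 0 := by
  have := ed_ne t h i
  rcases lt_or_gt_of_ne h with h1 | h1 <;> simp [dir, sign_neg, sign_pos, h1, this]

/-- two half planes disjoint means opposite -/
lemma opp {d e : ℂ} (hd : d ≠ 0) (he : e ≠ 0) (H : ∀ w, 0 < cr d w → 0 < cr e w → False) :
    ∃ k : ℝ, 0 < k ∧ e = -(k * d) := by
  have nd : 0 < d.re^2 + d.im^2 := by
    by_contra hc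
    apply hd
    apply Complex.ext <;> simp <;> nlinarith [sq_nonneg d.re, sq_nonneg d.im]
  have ne : 0 < e.re^2 + e.im^2 := by
    by_contra hc
    apply he
    apply Complex.ext <;> simp <;> nlinarith [sq_nonneg e.re, sq_nonneg e.im]
  set p := d.re * e.re + d.im * e.im with hp
  set q := cr d e with hq
  have pq : p^2 + q^2 = (d.re^2 + d.im^2) * (e.re^2 + e.im^2) := by simp only [hp, hq, cr]; ring
  have q0 : q = 0 := by
    by_contra hq0
    -- w = s*e - r*d
    have h1 := H ((q:ℂ) * e - q * d)
    have e1 : cr d ((q:ℂ) * e - q * d) = q^2 := by simp [cr, hq]; ring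
    have e2 : cr e ((q:ℂ) * e - q * d) = q^2 := by simp [cr, hq]; ring
    rw [e1, e2] at h1
    exact h1 (by positivity) (by positivity)
  have p0 : p < 0 := by
    by_contra hp0
    push Not at hp0
    have pp : 0 < p := by
      rcases hp0.lt_or_eq with h | h
      · exact h
      · rw [q0, ← h] at pq; nlinarith [mul_pos nd ne]
    have h1 := H (Complex.I * d)
    have e1 : cr d (Complex.I * d) = d.re^2 + d.im^2 := by simp [cr]; ring
    have e2 : cr e (Complex.I * d) = p := by simp [cr, hp]; ring
    rw [e1, e2] at h1
    exact h1 nd pp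
  refine ⟨-p / (d.re^2 + d.im^2), by apply div_pos <;> linarith, ?_⟩
  have q0' : d.re * e.im - d.im * e.re = 0 := q0
  apply Complex.ext
  · simp only [Complex.neg_re, Complex.re_ofReal_mul]
    field_simp
    simp only [hp]; linear_combination (-d.im) * q0'
  · simp only [Complex.neg_im, Complex.im_ofReal_mul]
    field_simp
    simp only [hp]; linear_combination (d.re) * q0'

/-- local structure: outside -/
lemma loc_out (t : Trc) (h : dt t ≠ 0) {x : ℂ} (hx : x ∉ hull t) :
    ∀ᶠ y in nhds x, y ∉ hull t := (hull_closed t h).isOpen_compl.mem_nhds hx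

lemma loc_edge (t : Trc) (h : dt t ≠ 0) (i : Fin 3) {x : ℂ} (hx : x ∈ oe t i) :
    ∀ᶠ y in nhds x, (y ∈ hull t ↔ 0 ≤ cr (dir t i) (y - x)) ∧
      (y ∈ interior (hull t) ↔ 0 < cr (dir t i) (y - x)) := by
  have h1 : ∀ᶠ y in nhds x, 0 < bc t (i+1) y :=
    (bc_cont t (i+1)).continuousAt.eventually (lt_mem_nhds hx.2.1)
  have h2 : ∀ᶠ y in nhds x, 0 < bc t (i+2) y :=
    (bc_cont t (i+2)).continuousAt.eventually (lt_mem_nhds hx.2.2)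
  filter_upwards [h1, h2] with y hy1 hy2
  have e : bc t i y = cr (ed t i) (y - x) / dt t := by
    have := bc_line t i x (y - x) 1
    simp at this
    rw [this, hx.1]; simp
  obtain ⟨k, hk, e2⟩ := cr_dir t h i (y - x)
  rw [e2] at e
  have cas := fin3_cas i
  constructor
  · rw [hull_eq t h]
    constructor
    · intro hh
      have := hh i
      rw [e] at this
      exact nonneg_of_mul_nonneg_right this hk
    · intro hh j
      rcases cas j with rfl | rfl | rfl
      · rw [e]; positivity
      · exact hy1.le
      · exact hy2.le
  · rw [interior_hull t h]
    constructor
    · intro hh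
      have := hh i
      rw [e] at this
      exact pos_of_mul_pos_right this hk.le
    · intro hh j
      rcases cas j with rfl | rfl | rfl
      · rw [e]; positivity
      · exact hy1
      · exact hy2

end TT
end

section
namespace TT

structure Til (N : ℕ) (A : Trc) (t : Fin N → Trc) : Prop where
  hA : dt A ≠ 0
  ht : ∀ j, dt (t j) ≠ 0
  disj : ∀ j l, j ≠ l → ∀ x, x ∈ interior (hull (t j)) → x ∈ interior (hull (t l)) → False
  cover : ∀ x, x ∈ hull A ↔ ∃ j, x ∈ hull (t j)

lemma tend_line (x w : ℂ) : Filter.Tendsto (fun s : ℝ => x + s * w) (nhdsWithin 0 (Set.Ioi 0)) (nhds x) := by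
  have : Continuous (fun s : ℝ => x + s * w) := by fun_prop
  have h := this.tendsto 0
  simp only [Complex.ofReal_zero, zero_mul, add_zero] at h
  exact h.mono_left nhdsWithin_le_nhds

lemma cr_smul (d w : ℂ) (s : ℝ) : cr d (s * w) = s * cr d w := by simp [cr]; ring

lemma cr_neg (d w : ℂ) : cr (-d) w = - cr d w := by simp [cr]; ring

lemma loc_edge_line (t : Trc) (h : dt t ≠ 0) (i : Fin 3) {x : ℂ} (hx : x ∈ oe t i) (w : ℂ) :
    ∀ᶠ s : ℝ in nhdsWithin 0 (Set.Ioi 0), (x + s * w ∈ hull t ↔ 0 ≤ cr (dir t i) w) ∧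
      (x + s * w ∈ interior (hull t) ↔ 0 < cr (dir t i) w) := by
  filter_upwards [(tend_line x w).eventually (loc_edge t h i hx), self_mem_nhdsWithin] with s hs hs0
  have hs0 : 0 < s := hs0
  rw [add_sub_cancel_left, cr_smul] at hs
  rw [hs.1, hs.2]
  constructor
  · constructor
    · intro h; exact nonneg_of_mul_nonneg_right h hs0
    · intro h; positivity
  · constructor
    · intro h; exact pos_of_mul_pos_right h hs0.le
    · intro h; positivity

variable {N : ℕ} {A : Trc} {t : Fin N → Trc}

lemma Til.sub (H : Til N A t) (j : Fin N) : hull (t j) ⊆ hull A := fun x hx => (H.cover x).2 ⟨j, hx⟩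

lemma Til.pair (H : Til N A t) {x : ℂ} {p q : Fin N × Fin 3} (hp : x ∈ oe (t p.1) p.2)
    (hq : x ∈ oe (t q.1) q.2) (hpq : p ≠ q) :
    ∃ k : ℝ, 0 < k ∧ dir (t q.1) q.2 = -(k * dir (t p.1) p.2) := by
  have hne : p.1 ≠ q.1 := by
    intro h
    rw [← h] at hq
    exact hpq (Prod.ext h (oe_unique _ hp hq))
  apply opp (dir_ne _ (H.ht _) _) (dir_ne _ (H.ht _) _)
  intro w h1 h2
  obtain ⟨s, e1, e2⟩ := ((loc_edge_line _ (H.ht _) _ hp w).and (loc_edge_line _ (H.ht _) _ hq w)).exists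
  exact H.disj _ _ hne _ (e1.2.2 h1) (e2.2.2 h2)

lemma neg_pos_absurd {d : ℂ} (hd : d ≠ 0) {k l : ℝ} (hk : 0 < k) (hl : 0 < l) (h : (k:ℂ) * d = -(l * d)) : False := by
  have : ((k + l : ℝ) : ℂ) * d = 0 := by push_cast; linear_combination h
  rcases mul_eq_zero.1 this with h | h
  · have := Complex.ofReal_eq_zero.1 h; linarith
  · exact hd h

lemma Til.no_three (H : Til N A t) {x : ℂ} {p q r : Fin N × Fin 3} (hp : x ∈ oe (t p.1) p.2)
    (hq : x ∈ oe (t q.1) q.2) (hr : x ∈ oe (t r.1) r.2) (hpq : p ≠ q) (hpr : p ≠ r) (hqr : q ≠ r) : False := by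
  obtain ⟨k, hk, e1⟩ := H.pair hp hq hpq
  obtain ⟨l, hl, e2⟩ := H.pair hp hr hpr
  obtain ⟨m, hm, e3⟩ := H.pair hq hr hqr
  apply neg_pos_absurd (dir_ne _ (H.ht p.1) p.2) (mul_pos hm hk) hl
  rw [e1, e2] at e3
  push_cast
  linear_combination -e3

lemma oe_near_int (t : Trc) (h : dt t ≠ 0) (i : Fin 3) {x : ℂ} (hx : x ∈ oe t i) :
    ∀ᶠ s : ℝ in nhdsWithin 0 (Set.Ioi 0), x + s * (Complex.I * dir t i) ∈ interior (hull t) := by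
  filter_upwards [loc_edge_line t h i hx (Complex.I * dir t i)] with s hs
  apply hs.2.2
  have := dir_ne t h i
  have : cr (dir t i) (Complex.I * dir t i) = Complex.normSq (dir t i) := by
    simp [cr, Complex.normSq_apply]
  rw [this]
  exact Complex.normSq_pos.2 (dir_ne t h i)

lemma Til.exists_other (H : Til N A t) {x : ℂ} (hx : x ∈ interior (hull A)) (hv : ∀ j i, x ≠ t j i)
    {p : Fin N × Fin 3} (hp : x ∈ oe (t p.1) p.2) : ∃ q, q ≠ p ∧ x ∈ oe (t q.1) q.2 := by
  set d := dir (t p.1) p.2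
  set w := -(Complex.I * d)
  have hw : cr d w < 0 := by
    have : cr d w = -Complex.normSq d := by
      simp [cr, w, Complex.normSq_apply]; ring
    rw [this]
    have := Complex.normSq_pos.2 (dir_ne _ (H.ht p.1) p.2)
    simpa using this
  have h1 : ∀ᶠ s : ℝ in nhdsWithin 0 (Set.Ioi 0), x + s * w ∈ hull A :=
    (tend_line x w).eventually (mem_interior_iff_mem_nhds.1 hx)
  have h2 : ∀ᶠ s : ℝ in nhdsWithin 0 (Set.Ioi 0), ∃ j, x + s * w ∈ hull (t j) :=
    h1.mono fun s hs => (H.cover _).1 hs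
  have h3 : ∃ j, ∃ᶠ s : ℝ in nhdsWithin 0 (Set.Ioi 0), x + s * w ∈ hull (t j) := by
    by_contra hc
    push Not at hc
    have := Filter.eventually_all.2 hc
    obtain ⟨s, ⟨j, hj⟩, hs⟩ := (h2.and this).exists
    exact hs j hj
  obtain ⟨j, hj⟩ := h3
  have hxj : x ∈ hull (t j) := by
    by_contra hc
    obtain ⟨s, h, h'⟩ := (hj.and_eventually ((tend_line x w).eventually (loc_out _ (H.ht j) hc))).exists
    exact h' h
  have hjp : j ≠ p.1 := by
    rintro rfl
    obtain ⟨s, h, h'⟩ := (hj.and_eventually (loc_edge_line _ (H.ht p.1) p.2 hp w)).exists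
    exact absurd (h'.1.1 h) (not_le.2 hw)
  rcases hull_cases _ (H.ht j) hxj (hv j) with hc | ⟨i, hi⟩
  · exfalso
    obtain ⟨s, e1, e2⟩ := ((oe_near_int _ (H.ht p.1) p.2 hp).and
      ((tend_line x _).eventually (isOpen_interior.mem_nhds hc))).exists
    exact H.disj _ _ hjp _ e2 e1
  · refine ⟨(j, i), ?_, hi⟩
    rintro rfl
    exact hjp rfl

/-- on the boundary -/
lemma Til.bdry_dir (H : Til N A t) {x : ℂ} {k : Fin 3} (hx : x ∈ oe A k)
    {p : Fin N × Fin 3} (hp : x ∈ oe (t p.1) p.2) :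
    ∃ r : ℝ, 0 < r ∧ dir A k = r * dir (t p.1) p.2 := by
  have : ∃ r : ℝ, 0 < r ∧ -dir A k = -(r * dir (t p.1) p.2) := by
    apply opp (dir_ne _ (H.ht _) _) (neg_ne_zero.2 (dir_ne _ H.hA _))
    intro w h1 h2
    rw [cr_neg] at h2
    obtain ⟨s, e1, e2⟩ := ((loc_edge_line _ (H.ht _) _ hp w).and (loc_edge_line _ H.hA _ hx w)).exists
    have := e2.1.1 (H.sub p.1 (e1.1.2 h1.le))
    linarith
  obtain ⟨r, hr, e⟩ := this
  exact ⟨r, hr, neg_injective e⟩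

lemma Til.bdry_unique (H : Til N A t) {x : ℂ} {k : Fin 3} (hx : x ∈ oe A k)
    {p q : Fin N × Fin 3} (hp : x ∈ oe (t p.1) p.2) (hq : x ∈ oe (t q.1) q.2) : p = q := by
  by_contra hpq
  obtain ⟨k, hk, e1⟩ := H.pair hp hq hpq
  obtain ⟨l, hl, e2⟩ := H.bdry_dir hx hp
  obtain ⟨m, hm, e3⟩ := H.bdry_dir hx hq
  apply neg_pos_absurd (dir_ne _ (H.ht p.1) p.2) hl (mul_pos hm hk)
  rw [← e2, e3, e1]
  push_cast; ring

lemma Til.bdry_exists (H : Til N A t) {x : ℂ} {k : Fin 3} (hx : x ∈ oe A k) (hv : ∀ j i, x ≠ t j i) :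
    ∃ p : Fin N × Fin 3, x ∈ oe (t p.1) p.2 := by
  obtain ⟨j, hj⟩ := (H.cover x).1 (oe_sub _ H.hA k hx)
  rcases hull_cases _ (H.ht j) hj (hv j) with hc | ⟨i, hi⟩
  · exact absurd (interior_mono (H.sub j) hc) (oe_not_int _ H.hA k hx)
  · exact ⟨(j, i), hi⟩

lemma Til.chain (H : Til N A t) (χ : ℂ → ℝ) (hs : ∀ z, z ≠ 0 → ∀ k : ℝ, 0 < k → χ (k * z) = χ z)
    (ho : ∀ z, z ≠ 0 → χ (-z) = -χ z) {x : ℂ} (hv : ∀ j i, x ≠ t j i) (hvA : ∀ i, x ≠ A i) :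
    ∑ p : Fin N × Fin 3, χ (dir (t p.1) p.2) * (oe (t p.1) p.2).indicator 1 x
      = ∑ k, χ (dir A k) * (oe A k).indicator 1 x := by
  classical
  by_cases hA : x ∈ hull A
  · rcases hull_cases _ H.hA hA hvA with hi | ⟨k, hk⟩
    · have r0 : ∑ k, χ (dir A k) * (oe A k).indicator 1 x = 0 := by
        apply Finset.sum_eq_zero
        intro k _
        rw [Set.indicator_of_notMem, mul_zero]
        intro h
        exact oe_not_int _ H.hA k h hi
      rw [r0]
      by_cases hp : ∃ p : Fin N × Fin 3, x ∈ oe (t p.1) p.2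
      · obtain ⟨p, hp⟩ := hp
        obtain ⟨q, hqp, hq⟩ := H.exists_other hi hv hp
        rw [← Finset.sum_subset (Finset.subset_univ {p, q})]
        · rw [Finset.sum_pair hqp.symm, Set.indicator_of_mem hp, Set.indicator_of_mem hq]
          obtain ⟨k, hk, e⟩ := H.pair hp hq hqp.symm
          have d0 := dir_ne _ (H.ht p.1) p.2
          rw [e, ho _ (mul_ne_zero (by simpa using hk.ne') d0), hs _ d0 _ hk]
          simp
        · intro r _ hr
          rw [Set.indicator_of_notMem, mul_zero]
          intro h
          simp only [Finset.mem_insert, Finset.mem_singleton, not_or] at hr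
          exact H.no_three hp hq h hqp.symm (Ne.symm hr.1) (Ne.symm hr.2)
      · push Not at hp
        apply Finset.sum_eq_zero
        intro k _
        rw [Set.indicator_of_notMem (hp k), mul_zero]
    · obtain ⟨p, hp⟩ := H.bdry_exists hk hv
      rw [Finset.sum_eq_single_of_mem p (Finset.mem_univ _), Finset.sum_eq_single_of_mem k (Finset.mem_univ _)]
      · rw [Set.indicator_of_mem hp, Set.indicator_of_mem hk]
        obtain ⟨r, hr, e⟩ := H.bdry_dir hk hp
        rw [e, hs _ (dir_ne _ (H.ht p.1) p.2) _ hr]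
      · intro l _ hl
        rw [Set.indicator_of_notMem, mul_zero]
        intro h
        exact hl (oe_unique _ h hk)
      · intro l _ hl
        rw [Set.indicator_of_notMem, mul_zero]
        intro h
        exact hl (H.bdry_unique hk h hp)
  · rw [Finset.sum_eq_zero, Finset.sum_eq_zero]
    · intro k _
      rw [Set.indicator_of_notMem, mul_zero]
      intro h
      exact hA (oe_sub _ H.hA _ h)
    · intro k _
      rw [Set.indicator_of_notMem, mul_zero]
      intro h
      exact hA (H.sub _ (oe_sub _ (H.ht _) _ h))

open MeasureTheory MeasureTheory.Measure

lemma oe_meas (t : Trc) (i : Fin 3) : MeasurableSet (oe t i) := by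
  have h0 := (bc_cont t i).measurable
  have h1 := (bc_cont t (i+1)).measurable
  have h2 := (bc_cont t (i+2)).measurable
  apply MeasurableSet.inter
  · exact measurableSet_eq_fun h0 measurable_const
  apply MeasurableSet.inter
  · exact measurableSet_lt measurable_const h1
  · exact measurableSet_lt measurable_const h2

lemma oe_H (t : Trc) (h : dt t ≠ 0) (i : Fin 3) :
    μH[1] (oe t i) = ENNReal.ofReal ‖ed t i‖ := by
  have e : μH[1] (oe t i) = μH[1] (segment ℝ (t (i+1)) (t (i+2))) := by
    rw [oe_eq t h]
    apply le_antisymm (measure_mono (openSegment_subset_segment _ _ _))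
    have hs : segment ℝ (t (i+1)) (t (i+2)) ⊆ openSegment ℝ (t (i+1)) (t (i+2)) ∪ {t (i+1), t (i+2)} := by
      rw [← insert_endpoints_openSegment]
      intro x hx
      simp at hx ⊢
      tauto
    have := Measure.nullSingletonClass_hausdorff ℂ (d := 1) (by norm_num)
    calc _ ≤ μH[1] (openSegment ℝ (t (i+1)) (t (i+2)) ∪ {t (i+1), t (i+2)}) := measure_mono hs
      _ ≤ _ := measure_union_le _ _
      _ = _ := by
        rw [(Set.toFinite {t (i+1), t (i+2)}).measure_zero, add_zero]
  rw [e, hausdorffMeasure_segment, edist_dist, dist_comm, dist_eq_norm]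
  rfl

lemma oe_int (t : Trc) (h : dt t ≠ 0) (i : Fin 3) :
    ∫ x, (oe t i).indicator (1 : ℂ → ℝ) x ∂μH[1] = ‖ed t i‖ := by
  rw [integral_indicator_one (oe_meas t i), Measure.real, oe_H t h i, ENNReal.toReal_ofReal (norm_nonneg _)]

lemma oe_integrable (t : Trc) (h : dt t ≠ 0) (i : Fin 3) :
    Integrable ((oe t i).indicator (1 : ℂ → ℝ)) (μH[1]) := by
  rw [integrable_indicator_iff (oe_meas t i)]
  apply integrableOn_const
  · rw [oe_H t h i]; exact ENNReal.ofReal_ne_top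
  · simp

lemma Til.ae_nv (t : Fin N → Trc) (A : Trc) :
    ∀ᵐ x ∂(μH[1] : Measure ℂ), (∀ j i, x ≠ t j i) ∧ (∀ i, x ≠ A i) := by
  have := Measure.nullSingletonClass_hausdorff ℂ (d := 1) (by norm_num)
  have h1 : (Set.range (fun p : Fin N × Fin 3 => t p.1 p.2) ∪ Set.range A).Finite :=
    (Set.finite_range _).union (Set.finite_range _)
  filter_upwards [measure_eq_zero_iff_ae_notMem.1 (h1.measure_zero μH[1])] with x hx
  simp only [Set.mem_union, Set.mem_range, not_or, not_exists] at hx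
  exact ⟨fun j i h => hx.1 (j, i) h.symm, fun i h => hx.2 i h.symm⟩

def per (χ : ℂ → ℝ) (t : Trc) : ℝ := ∑ i, χ (dir t i) * ‖ed t i‖

lemma Til.per_eq (H : Til N A t) (χ : ℂ → ℝ) (hs : ∀ z, z ≠ 0 → ∀ k : ℝ, 0 < k → χ (k * z) = χ z)
    (ho : ∀ z, z ≠ 0 → χ (-z) = -χ z) : ∑ j, per χ (t j) = per χ A := by
  have h := integral_congr_ae ((Til.ae_nv t A).mono fun x hx => H.chain χ hs ho hx.1 hx.2)
  rw [integral_finsetSum, integral_finsetSum] at h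
  · simp only [integral_const_mul, oe_int _ (H.ht _), oe_int _ H.hA] at h
    rw [Fintype.sum_prod_type] at h
    exact h
  · intro k _; exact (oe_integrable _ H.hA _).const_mul _
  · intro k _; exact (oe_integrable _ (H.ht _) _).const_mul _


/-- edges lying on the side k of A -/
def onS (A : Trc) (t : Fin N → Trc) (k : Fin 3) (p : Fin N × Fin 3) : Prop :=
  bc A k (t p.1 (p.2 + 1)) = 0 ∧ bc A k (t p.1 (p.2 + 2)) = 0

lemma onS_line (k : Fin 3) (p : Fin N × Fin 3) (h : onS A t k p) {x : ℂ}
    (hx : x ∈ segment ℝ (t p.1 (p.2+1)) (t p.1 (p.2+2))) : bc A k x = 0 := by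
  obtain ⟨s, r, hs, hr, hsr, rfl⟩ := hx
  rw [bc_comb _ _ _ _ _ _ hsr, h.1, h.2]; simp

lemma Til.onS_of (H : Til N A t) {x : ℂ} {k : Fin 3} (hx : x ∈ oe A k)
    {p : Fin N × Fin 3} (hp : x ∈ oe (t p.1) p.2) : onS A t k p := by
  obtain ⟨r, hr, e⟩ := H.bdry_dir hx hp
  have hp' := hp
  rw [oe_eq _ (H.ht _)] at hp'
  obtain ⟨s, q, hs, hq, hsq, rfl⟩ := hp'
  have key : ∀ y : ℂ, ∀ l : ℝ, bc A k (s • t p.1 (p.2 + 1) + q • t p.1 (p.2 + 2) + l * dir (t p.1) p.2) = 0 := by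
    intro y l
    rw [bc_line, hx.1]
    obtain ⟨m, hm, e2⟩ := cr_dir A H.hA k (dir (t p.1) p.2)
    rw [e2, e]
    simp [cr]; right; right; ring
  set sg : ℝ := (SignType.sign (dt (t p.1)) : ℝ) with hsg
  have sg2 : (sg : ℂ) * sg = 1 := by
    rcases lt_or_gt_of_ne (H.ht p.1) with h1 | h1 <;> simp [hsg, sign_neg, sign_pos, h1]
  have sq : (s : ℂ) + q = 1 := by exact_mod_cast hsq
  constructor
  · have := key 0 (-(q * sg))
    convert this using 2
    simp only [dir, ← hsg, ed, Complex.real_smul]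
    push_cast
    linear_combination (-(t p.1 (p.2+1))) * sq + q * (t p.1 (p.2 + 2) - t p.1 (p.2 + 1)) * sg2
  · have := key 0 (s * sg)
    convert this using 2
    simp only [dir, ← hsg, ed, Complex.real_smul]
    push_cast
    linear_combination (-(t p.1 (p.2+2))) * sq - s * (t p.1 (p.2 + 2) - t p.1 (p.2 + 1)) * sg2

open Classical in
lemma Til.side_ind (H : Til N A t) (k : Fin 3) {x : ℂ} (hv : ∀ j i, x ≠ t j i) (hvA : ∀ i, x ≠ A i) :
    ∑ p : Fin N × Fin 3 with onS A t k p, (oe (t p.1) p.2).indicator (1 : ℂ → ℝ) x = (oe A k).indicator 1 x := by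
  by_cases hk : x ∈ oe A k
  · obtain ⟨p, hp⟩ := H.bdry_exists hk hv
    rw [Finset.sum_eq_single_of_mem p (by simpa using H.onS_of hk hp), Set.indicator_of_mem hp, Set.indicator_of_mem hk]
    intro l _ hl
    rw [Set.indicator_of_notMem]
    intro h
    exact hl (H.bdry_unique hk h hp)
  · rw [Set.indicator_of_notMem hk]
    apply Finset.sum_eq_zero
    intro p hp
    rw [Set.indicator_of_notMem]
    intro h
    simp only [Finset.mem_filter, Finset.mem_univ, true_and] at hp
    have h1 : x ∈ hull A := H.sub _ (oe_sub _ (H.ht _) _ h)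
    have h2 : bc A k x = 0 := by
      apply onS_line k p hp
      rw [oe_eq _ (H.ht _)] at h
      exact openSegment_subset_segment _ _ _ h
    rcases hull_cases _ H.hA h1 hvA with hi | ⟨m, hm⟩
    · rw [interior_hull _ H.hA] at hi
      exact absurd h2 (hi k).ne'
    · rcases fin3_cas m k with rfl | rfl | rfl
      · exact hk hm
      · exact absurd h2 hm.2.1.ne'
      · exact absurd h2 hm.2.2.ne'

open Classical in
lemma Til.side_len (H : Til N A t) (k : Fin 3) :
    ∑ p : Fin N × Fin 3 with onS A t k p, ‖ed (t p.1) p.2‖ = ‖ed A k‖ := by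
  have h := integral_congr_ae ((Til.ae_nv t A).mono fun x hx => H.side_ind k hx.1 hx.2)
  rw [integral_finsetSum] at h
  · simpa only [oe_int _ (H.ht _), oe_int _ H.hA] using h
  · intro k _; exact (oe_integrable _ (H.ht _) _)

/-- a corner point in a tile is a vertex; segment version -/
lemma corner_extreme (A : Trc) (h : dt A ≠ 0) (i : Fin 3) {x y : ℂ} (hx : x ∈ hull A) (hy : y ∈ hull A)
    (hs : A i ∈ segment ℝ x y) : A i = x ∨ A i = y := by
  obtain ⟨s, r, hs0, hr0, hsr, e⟩ := hs
  rw [hull_eq _ h] at hx hy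
  have h1 := bc_succ A (i+1)
  have h2 := bc_succ2 A (i+1)
  have v : ∀ z : ℂ, z ∈ {x | ∀ i, 0 ≤ bc A i x} → bc A (i+1) z = 0 → bc A (i+2) z = 0 → A i = z := by
    intro z hz e1 e2
    have e0 := bc_sum A h z
    have e3 := bc_rep A h z
    rw [e3]
    fin_cases i <;> simp at e1 e2 <;> simp only [e1, e2] at e0 ⊢ <;> simp at e0 ⊢ <;> simp [e0]
  have z1 : bc A (i+1) (A i) = 0 := by
    have := bc_succ2 A (i+1); rwa [add_assoc, show (1:Fin 3)+2 = 0 by decide, add_zero] at this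
  have z2 : bc A (i+2) (A i) = 0 := by
    have := bc_succ A (i+2); rwa [add_assoc, show (2:Fin 3)+1 = 0 by decide, add_zero] at this
  rw [← e, bc_comb _ _ _ _ _ _ hsr] at z1 z2
  have a1 := hx (i+1); have a2 := hx (i+2); have a3 := hy (i+1); have a4 := hy (i+2)
  rcases hs0.eq_or_lt with h0 | h0
  · right
    rw [← h0] at e hsr
    rw [← e]; rw [zero_add] at hsr; simp [hsr]
  · left
    apply v x hx
    · have : s * bc A (i+1) x = 0 := by
        have := mul_nonneg hs0 a1; have := mul_nonneg hr0 a3; linarith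
      rcases mul_eq_zero.1 this with h | h
      · exact absurd h h0.ne'
      · exact h
    · have : s * bc A (i+2) x = 0 := by
        have := mul_nonneg hs0 a2; have := mul_nonneg hr0 a4; linarith
      rcases mul_eq_zero.1 this with h | h
      · exact absurd h h0.ne'
      · exact h

lemma Til.side_corner (H : Til N A t) (k : Fin 3) {e : Fin 3} (he : e = k + 1 ∨ e = k + 2) :
    ∃ p : Fin N × Fin 3, onS A t k p ∧ (A e = t p.1 (p.2 + 1) ∨ A e = t p.1 (p.2 + 2)) := by
  obtain ⟨f, hf⟩ : ∃ f, segment ℝ (A e) (A f) = segment ℝ (A (k+1)) (A (k+2)) ∧ oe A k = openSegment ℝ (A e) (A f) := by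
    rcases he with rfl | rfl
    · exact ⟨k+2, rfl, oe_eq _ H.hA _⟩
    · exact ⟨k+1, segment_symm _ _ _, by rw [openSegment_symm]; exact oe_eq _ H.hA _⟩
  have hef : A f - A e ≠ 0 := by
    intro hc
    have hc' : A f = A e := by linear_combination hc
    have h1 : μH[1] (oe A k) = 0 := by
      rw [hf.2, hc', openSegment_same]
      have := Measure.nullSingletonClass_hausdorff ℂ (d := 1) (by norm_num)
      exact measure_singleton _
    rw [oe_H _ H.hA, ENNReal.ofReal_eq_zero] at h1
    exact ed_ne _ H.hA k (norm_le_zero_iff.1 h1)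
  have hfin : (Set.range (fun p : Fin N × Fin 3 => t p.1 p.2)).Finite := Set.finite_range _
  have ev : ∀ᶠ s : ℝ in nhdsWithin 0 (Set.Ioi 0), ∀ j i, A e + s * (A f - A e) ≠ t j i := by
    rw [Filter.eventually_all]; intro j
    rw [Filter.eventually_all]; intro i
    by_cases hji : A e = t j i
    · filter_upwards [self_mem_nhdsWithin] with s hs hc
      have hs : 0 < s := hs
      rw [hji] at hc
      have : (s:ℂ) * (A f - t j i) = 0 := by linear_combination hc
      rcases mul_eq_zero.1 this with h | h
      · have := Complex.ofReal_eq_zero.1 h; linarith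
      · rw [← hji] at h; exact hef h
    · exact (tend_line _ _).eventually (isOpen_ne.mem_nhds hji)
  have ev2 : ∀ᶠ s : ℝ in nhdsWithin 0 (Set.Ioi 0), s < 1 := nhdsWithin_le_nhds (gt_mem_nhds (by norm_num))
  have ev3 : ∀ᶠ s : ℝ in nhdsWithin 0 (Set.Ioi 0), ∃ p : Fin N × Fin 3, onS A t k p ∧
      A e + s * (A f - A e) ∈ segment ℝ (t p.1 (p.2+1)) (t p.1 (p.2+2)) := by
    filter_upwards [ev, ev2, self_mem_nhdsWithin] with s h1 h2 h3
    have h3 : 0 < s := h3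
    have hm : A e + s * (A f - A e) ∈ oe A k := by
      rw [hf.2]
      refine ⟨1 - s, s, by linarith, h3, by ring, ?_⟩
      simp; ring
    obtain ⟨p, hp⟩ := H.bdry_exists hm h1
    refine ⟨p, H.onS_of hm hp, ?_⟩
    rw [oe_eq _ (H.ht _)] at hp
    exact openSegment_subset_segment _ _ _ hp
  have ⟨p, hp⟩ : ∃ p : Fin N × Fin 3, ∃ᶠ s : ℝ in nhdsWithin 0 (Set.Ioi 0), onS A t k p ∧
      A e + s * (A f - A e) ∈ segment ℝ (t p.1 (p.2+1)) (t p.1 (p.2+2)) := by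
    by_contra hc
    push Not at hc
    have := Filter.eventually_all.2 hc
    obtain ⟨s, ⟨j, hj⟩, hs⟩ := (ev3.and this).exists
    exact hs j hj.1 hj.2
  obtain ⟨-, hon, -⟩ := hp.exists
  refine ⟨p, hon, ?_⟩
  have hcl : IsClosed (segment ℝ (t p.1 (p.2+1)) (t p.1 (p.2+2))) := by
    rw [← convexHull_pair]
    exact (Set.toFinite _).isClosed_convexHull ℝ
  have hmem : A e ∈ segment ℝ (t p.1 (p.2+1)) (t p.1 (p.2+2)) := by
    by_contra hc
    obtain ⟨s, h, h'⟩ := (hp.and_eventually ((tend_line (A e) (A f - A e)).eventually (hcl.isOpen_compl.mem_nhds hc))).exists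
    exact h' h.2
  exact corner_extreme A H.hA e (H.sub p.1 (subset_convexHull _ _ ⟨_, rfl⟩)) (H.sub p.1 (subset_convexHull _ _ ⟨_, rfl⟩)) hmem

end TT
end

section
namespace TT
open MeasureTheory MeasureTheory.Measure

def cone (z w : ℂ) : Set ℂ := {y | 0 ≤ cr z y / cr z w ∧ 0 ≤ cr y w / cr z w}

lemma cone_swap (z w : ℂ) : cone z w = cone w z := by
  ext y
  have h1 : cr w z = - cr z w := by simp [cr]; ring
  have h2 : cr w y = - cr y w := by simp [cr]; ring
  have h3 : cr y z = - cr z y := by simp [cr]; ring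
  simp only [cone, Set.mem_ofPred_eq, h1, h2, h3, neg_div_neg_eq]
  tauto

lemma cr_rot (c x y : ℂ) : cr (c * x) (c * y) = Complex.normSq c * cr x y := by
  simp [cr, Complex.normSq_apply]; ring

lemma cr_polar (a b : ℝ) (s r : ℝ) :
    cr (s * (Complex.cos a + Complex.sin a * Complex.I)) (r * (Complex.cos b + Complex.sin b * Complex.I))
      = s * r * Real.sin (b - a) := by
  rw [Real.sin_sub]
  simp [cr, ← Complex.ofReal_cos, ← Complex.ofReal_sin]; ring

lemma cr_zpolar (z : ℂ) (b r : ℝ) :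
    cr z (z * (r * (Complex.cos b + Complex.sin b * Complex.I))) = Complex.normSq z * (r * Real.sin b) := by
  simp [cr, Complex.normSq_apply, ← Complex.ofReal_cos, ← Complex.ofReal_sin]; ring

lemma sector_vol {θ r : ℝ} (h0 : 0 < θ) (h1 : θ < π) (hr : 0 < r) (S : Set ℂ) (hS : MeasurableSet S)
    (h : ∀ ρ φ : ℝ, 0 < ρ → -π < φ → φ < π →
      ((ρ * (Complex.cos φ + Complex.sin φ * Complex.I) : ℂ) ∈ S ↔ ρ < r ∧ 0 ≤ φ ∧ φ ≤ θ)) :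
    volume S = ENNReal.ofReal (r^2 * θ / 2) := by
  rw [← lintegral_indicator_one hS, ← Complex.lintegral_comp_polarCoord_symm]
  have e : ∀ p ∈ polarCoord.target,
      ENNReal.ofReal p.1 • S.indicator (1 : ℂ → ENNReal) (Complex.polarCoord.symm p) =
      (Set.Iio r ×ˢ Set.Icc 0 θ).indicator (fun p : ℝ × ℝ => ENNReal.ofReal p.1) p := by
    rintro ⟨ρ, φ⟩ hp
    simp only [polarCoord_target, Set.mem_prod, Set.mem_Ioi, Set.mem_Ioo] at hp
    have := h ρ φ hp.1 hp.2.1 hp.2.2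
    rw [Complex.polarCoord_symm_apply]
    simp only [← Complex.ofReal_cos, ← Complex.ofReal_sin] at this
    by_cases hm : ρ < r ∧ 0 ≤ φ ∧ φ ≤ θ
    · rw [Set.indicator_of_mem (this.2 hm), Set.indicator_of_mem]
      · simp
      · simpa using hm
    · rw [Set.indicator_of_notMem (fun hc => hm (this.1 hc)), Set.indicator_of_notMem]
      · simp
      · simpa using hm
  rw [setLIntegral_congr_fun polarCoord.open_target.measurableSet e,
    setLIntegral_indicator (by measurability), polarCoord_target, Set.prod_inter_prod]
  have e1 : Set.Iio r ∩ Set.Ioi (0:ℝ) = Set.Ioo 0 r := by ext; simp [and_comm]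
  have e2 : Set.Icc 0 θ ∩ Set.Ioo (-π) π = Set.Icc 0 θ := by
    apply Set.inter_eq_left.2
    intro x hx
    simp at hx ⊢
    constructor <;> linarith
  rw [e1, e2, Measure.volume_eq_prod, ← Measure.prod_restrict]
  have := lintegral_prod_mul (μ := volume.restrict (Set.Ioo 0 r)) (ν := volume.restrict (Set.Icc 0 θ))
    (f := fun x => ENNReal.ofReal x) (g := fun _ => 1) (by fun_prop) (by fun_prop)
  simp only [mul_one] at this
  rw [this]
  have i1 : ∫⁻ x in Set.Ioo 0 r, ENNReal.ofReal x = ENNReal.ofReal (r^2/2) := by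
    rw [← ofReal_integral_eq_lintegral_ofReal]
    · rw [← integral_Ioc_eq_integral_Ioo, ← intervalIntegral.integral_of_le hr.le, integral_id]; simp
    · exact (continuous_id.integrableOn_Icc).mono_set Set.Ioo_subset_Icc_self
    · filter_upwards [ae_restrict_mem measurableSet_Ioo] with x hx using hx.1.le
  rw [i1]
  simp
  rw [← ENNReal.ofReal_mul (by positivity)]
  congr 1; ring

lemma cone_vol_aux {z w : ℂ} (hz : z ≠ 0) (hw : w ≠ 0) (h0 : 0 < (w / z).arg) (h1 : (w / z).arg < π) {r : ℝ} (hr : 0 < r) :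
    volume (Metric.ball 0 r ∩ cone z w) = ENNReal.ofReal (r^2 * (w/z).arg / 2) := by
  set θ := (w/z).arg with hθ
  set R := ‖w / z‖ with hR
  have hR0 : 0 < R := by simp [hR, hz, hw]
  have nz : 0 < ‖z‖ := by simpa using hz
  have wz : w = z * (R * (Complex.cos θ + Complex.sin θ * Complex.I)) := by
    rw [hR, hθ, Complex.norm_mul_cos_add_sin_mul_I]
    field_simp
  have hcirc : ‖z / ‖z‖‖ = 1 := by simp [hz]
  set u : Circle := ⟨z / ‖z‖, by simp [Submonoid.unitSphere, hz]⟩ with hu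
  have mp := (rotation u).measurePreserving
  have hmeas : MeasurableSet (Metric.ball 0 r ∩ cone z w) := by
    apply Metric.isOpen_ball.measurableSet.inter
    apply MeasurableSet.inter
    · have hm : Measurable (fun y => cr z y / cr z w) := by unfold cr; fun_prop
      exact measurableSet_le measurable_const hm
    · have hm : Measurable (fun y => cr y w / cr z w) := by unfold cr; fun_prop
      exact measurableSet_le measurable_const hm
  rw [← mp.measure_preimage hmeas.nullMeasurableSet]
  apply sector_vol h0 h1 hr
  · exact mp.measurable hmeas
  · intro ρ φ hρ h3 h4
    have hru : (rotation u) (ρ * (Complex.cos φ + Complex.sin φ * Complex.I)) = z * ((ρ / ‖z‖ : ℝ) * (Complex.cos φ + Complex.sin φ * Complex.I)) := by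
      rw [rotation_apply, hu]; push_cast; field_simp
    have nrm : ‖(rotation u) (ρ * (Complex.cos φ + Complex.sin φ * Complex.I))‖ = ρ := by
      rw [LinearIsometryEquiv.norm_map]
      rw [norm_mul, Complex.norm_cos_add_sin_mul_I]; simp [abs_of_pos hρ]
    simp only [Set.mem_preimage, Set.mem_inter_iff, mem_ball_zero_iff, nrm]
    rw [hru]
    have n0 : 0 < Complex.normSq z := Complex.normSq_pos.2 hz
    have c1 : cr z w = Complex.normSq z * (R * Real.sin θ) := by
      conv_lhs => rw [wz]
      rw [cr_zpolar]
    have c2 : cr z (z * ((ρ / ‖z‖ : ℝ) * (Complex.cos φ + Complex.sin φ * Complex.I))) = Complex.normSq z * (ρ / ‖z‖ * Real.sin φ) := by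
      rw [cr_zpolar]
    have c3 : cr (z * ((ρ / ‖z‖ : ℝ) * (Complex.cos φ + Complex.sin φ * Complex.I))) w = Complex.normSq z * (ρ / ‖z‖ * R * Real.sin (θ - φ)) := by
      conv_lhs => rw [wz]
      rw [cr_rot, cr_polar]
    have s0 : 0 < Real.sin θ := Real.sin_pos_of_pos_of_lt_pi h0 h1
    simp only [cone, Set.mem_ofPred_eq, c1, c2, c3]
    have q0 : 0 < ρ / ‖z‖ := by positivity
    have q1 : (0 ≤ Complex.normSq z * (ρ / ‖z‖ * Real.sin φ) / (Complex.normSq z * (R * Real.sin θ))) ↔ 0 ≤ Real.sin φ := by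
      rw [le_div_iff₀ (by positivity), zero_mul, ]
      rw [mul_nonneg_iff_of_pos_left n0, mul_nonneg_iff_of_pos_left q0]
    have q2 : (0 ≤ Complex.normSq z * (ρ / ‖z‖ * R * Real.sin (θ - φ)) / (Complex.normSq z * (R * Real.sin θ))) ↔ 0 ≤ Real.sin (θ - φ) := by
      rw [le_div_iff₀ (by positivity), zero_mul, ]
      rw [mul_nonneg_iff_of_pos_left n0, mul_nonneg_iff_of_pos_left (by positivity)]
    rw [q1, q2]
    have r1 : 0 ≤ Real.sin φ ↔ 0 ≤ φ := by
      constructor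
      · intro h; by_contra hcon; push Not at hcon
        have := Real.sin_neg_of_neg_of_neg_pi_lt hcon h3
        linarith
      · intro h; exact Real.sin_nonneg_of_nonneg_of_le_pi h h4.le
    rw [r1]
    constructor
    · rintro ⟨h5, h6, h7⟩
      refine ⟨h5, h6, ?_⟩
      by_contra hcon; push Not at hcon
      have := Real.sin_neg_of_neg_of_neg_pi_lt (x := θ - φ) (by linarith) (by linarith)
      linarith
    · rintro ⟨h5, h6, h7⟩
      exact ⟨h5, h6, Real.sin_nonneg_of_nonneg_of_le_pi (by linarith) (by linarith)⟩

lemma cone_vol {z w : ℂ} (h : cr z w ≠ 0) {r : ℝ} (hr : 0 < r) :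
    volume (Metric.ball 0 r ∩ cone z w) = ENNReal.ofReal (r^2 * InnerProductGeometry.angle z w / 2) := by
  have hz : z ≠ 0 := by rintro rfl; simp [cr] at h
  have hw : w ≠ 0 := by rintro rfl; simp [cr] at h
  have him : (w / z).im ≠ 0 := by
    intro hc
    apply h
    have e : w = (w/z).re * z := by
      have : ((w/z).re : ℂ) = w / z := by apply Complex.ext <;> simp [hc]
      rw [this]; field_simp
    rw [e]; simp [cr]; ring
  have a0 : (w/z).arg ≠ 0 := by
    intro hc; exact him (Complex.arg_eq_zero_iff.1 hc).2
  have a1 : (w/z).arg ≠ π := by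
    intro hc; exact him (Complex.arg_eq_pi_iff.1 hc).2
  have a2 : (z/w).arg = -(w/z).arg := by
    rw [← inv_div, Complex.arg_inv, if_neg a1]
  have a3 := (Complex.arg_le_pi (w/z)).lt_of_ne a1
  have a4 := Complex.neg_pi_lt_arg (w/z)
  rw [Complex.angle_eq_abs_arg hz hw, a2, abs_neg]
  rcases lt_or_gt_of_ne a0 with h0 | h0
  · rw [abs_of_neg h0, cone_swap, ← a2]
    apply cone_vol_aux hw hz _ _ hr <;> rw [a2] <;> linarith
  · rw [abs_of_pos h0]
    exact cone_vol_aux hz hw h0 a3 hr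

def ang (t : Trc) (i : Fin 3) : ℝ := InnerProductGeometry.angle (t (i+1) - t i) (t (i+2) - t i)

lemma cr_dt (t : Trc) (i : Fin 3) : cr (t (i+1) - t i) (t (i+2) - t i) = dt t := by
  fin_cases i <;> simp [dt, cr] <;> ring

lemma vert_vol (t : Trc) (h : dt t ≠ 0) (i : Fin 3) :
    ∀ᶠ r : ℝ in nhdsWithin 0 (Set.Ioi 0), volume (Metric.ball (t i) r ∩ hull t) = ENNReal.ofReal (r^2 * ang t i / 2) := by
  have h1 : ∀ᶠ y in nhds (t i), 0 < bc t i y :=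
    (bc_cont t i).continuousAt.eventually (lt_mem_nhds (by rw [bc_self t h]; norm_num))
  obtain ⟨e, he, h2⟩ := Metric.eventually_nhds_iff.1 h1
  have h3 : ∀ᶠ r : ℝ in nhdsWithin 0 (Set.Ioi 0), r < e := nhdsWithin_le_nhds (gt_mem_nhds he)
  filter_upwards [h3, self_mem_nhdsWithin] with r hr hr0
  have hr0 : 0 < r := hr0
  have key : Metric.ball (t i) r ∩ hull t = (fun x => -t i + x) ⁻¹' (Metric.ball 0 r ∩ cone (t (i+1) - t i) (t (i+2) - t i)) := by
    ext x
    have n : dist (-t i + x) 0 = dist x (t i) := by rw [dist_eq_norm, dist_eq_norm]; congr 1; ring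
    simp only [Set.mem_inter_iff, Metric.mem_ball, Set.mem_preimage, n, cone, Set.mem_ofPred_eq, cr_dt]
    apply and_congr_right
    intro hd
    have hp := h2 (hd.trans hr)
    have e1 : cr (t (i+1) - t i) (-t i + x) / dt t = bc t (i+2) x := by
      rw [bc, ed]; congr 1
      rw [add_assoc, add_assoc, show (2:Fin 3) + 2 = 1 by decide, show (2:Fin 3)+1 = 0 by decide, add_zero]
      simp [cr]; ring
    have e2 : cr (-t i + x) (t (i+2) - t i) / dt t = bc t (i+1) x := by
      rw [bc, ed]; congr 1
      rw [add_assoc, add_assoc, show (1:Fin 3) + 2 = 0 by decide, show (1:Fin 3)+1 = 2 by decide, add_zero]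
      simp [cr]; ring
    rw [e1, e2, hull_eq t h]
    constructor
    · intro hx; exact ⟨hx _, hx _⟩
    · rintro ⟨hx1, hx2⟩ j
      rcases fin3_cas i j with rfl | rfl | rfl
      · exact hp.le
      · exact hx2
      · exact hx1
  rw [key, measure_preimage_add, cone_vol (by rw [cr_dt]; exact h) hr0, ang]

variable {N : ℕ} {A : Trc} {t : Fin N → Trc}

lemma hull_meas (t : Trc) (h : dt t ≠ 0) : MeasurableSet (hull t) := (hull_closed t h).measurableSet

lemma Til.vol (H : Til N A t) (B : Set ℂ) (hB : MeasurableSet B) :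
    ∑ j, volume (B ∩ hull (t j)) = volume (B ∩ hull A) := by
  have e : B ∩ hull A = ⋃ j, B ∩ hull (t j) := by
    ext x
    simp only [Set.mem_inter_iff, Set.mem_iUnion, H.cover]
    constructor
    · rintro ⟨h, j, hj⟩; exact ⟨j, h, hj⟩
    · rintro ⟨j, h, hj⟩; exact ⟨h, j, hj⟩
  rw [e, measure_iUnion₀, tsum_fintype]
  · intro j l hjl
    apply measure_mono_null (t := frontier (hull (t j)) ∪ frontier (hull (t l)))
    · rintro x ⟨⟨-, hj⟩, ⟨-, hl⟩⟩
      rw [(hull_closed _ (H.ht j)).frontier_eq, (hull_closed _ (H.ht l)).frontier_eq]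
      by_cases hi : x ∈ interior (hull (t j))
      · right; exact ⟨hl, fun hc => H.disj _ _ hjl _ hi hc⟩
      · left; exact ⟨hj, hi⟩
    · apply measure_union_null <;> exact (convex_convexHull ℝ _).addHaar_frontier _
  · intro j
    exact (hB.inter (hull_meas _ (H.ht j))).nullMeasurableSet

lemma vert_inj (t : Trc) (h : dt t ≠ 0) {i j : Fin 3} (e : t i = t j) : i = j := by
  rcases fin3_cas i j with rfl | rfl | rfl
  · rfl
  · have := bc_succ t i; rw [← e, bc_self t h] at this; norm_num at this
  · have := bc_succ2 t i; rw [← e, bc_self t h] at this; norm_num at this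

lemma corner_not_int (A : Trc) (h : dt A ≠ 0) (i : Fin 3) : A i ∉ interior (hull A) := by
  rw [interior_hull A h]
  intro hc
  have h1 := hc (i+1)
  have := bc_succ2 A (i+1); rw [add_assoc, show (1:Fin 3)+2 = 0 by decide, add_zero] at this
  linarith

lemma Til.corner_vert (H : Til N A t) (i : Fin 3) (j : Fin N) (h : A i ∈ hull (t j)) : ∃ k, A i = t j k := by
  by_contra hc
  push Not at hc
  rcases hull_cases _ (H.ht j) h hc with hi | ⟨k, hk⟩
  · exact corner_not_int A H.hA i (interior_mono (H.sub j) hi)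
  · rw [oe_eq _ (H.ht j)] at hk
    have := corner_extreme A H.hA i (H.sub j (subset_convexHull _ _ ⟨_, rfl⟩)) (H.sub j (subset_convexHull _ _ ⟨_, rfl⟩)) (openSegment_subset_segment _ _ _ hk)
    rcases this with h | h <;> exact hc _ h

lemma ang_nonneg (t : Trc) (i : Fin 3) : 0 ≤ ang t i := InnerProductGeometry.angle_nonneg _ _

open Classical in
lemma Til.corner_ang (H : Til N A t) (i : Fin 3) :
    ang A i = ∑ j, ∑ k, if t j k = A i then ang (t j) k else 0 := by
  have ev : ∀ j, ∀ᶠ r : ℝ in nhdsWithin 0 (Set.Ioi 0), volume (Metric.ball (A i) r ∩ hull (t j)) =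
      ENNReal.ofReal (r^2 / 2 * ∑ k, if t j k = A i then ang (t j) k else 0) := by
    intro j
    by_cases h : A i ∈ hull (t j)
    · obtain ⟨k, hk⟩ := H.corner_vert i j h
      filter_upwards [vert_vol (t j) (H.ht j) k] with r hr
      rw [hk, hr, Finset.sum_eq_single_of_mem k (Finset.mem_univ _)]
      · rw [if_pos rfl]; congr 1; ring
      · intro l _ hl
        rw [if_neg]
        intro hc; exact hl (vert_inj _ (H.ht j) hc)
    · have h1 : ∀ k, t j k ≠ A i := by
        rintro k hk
        exact h (hk ▸ subset_convexHull _ _ ⟨_, rfl⟩)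
      obtain ⟨e, he, h2⟩ := Metric.eventually_nhds_iff.1 (loc_out _ (H.ht j) h)
      have h3 : ∀ᶠ r : ℝ in nhdsWithin 0 (Set.Ioi 0), r < e := nhdsWithin_le_nhds (gt_mem_nhds he)
      filter_upwards [h3] with r hr
      have : Metric.ball (A i) r ∩ hull (t j) = ∅ := by
        ext x
        simp only [Set.mem_inter_iff, Metric.mem_ball, Set.mem_empty_iff_false, iff_false, not_and]
        intro hx
        exact h2 (hx.trans hr)
      rw [this]; simp [h1]
  obtain ⟨r, hr1, hr2, hr0⟩ := ((Filter.eventually_all.2 ev).and ((vert_vol A H.hA i).and self_mem_nhdsWithin)).exists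
  have hr0 : 0 < r := hr0
  have := H.vol (Metric.ball (A i) r) measurableSet_ball
  rw [hr2] at this
  simp only [hr1] at this
  have nn : ∀ j, 0 ≤ ∑ k, if t j k = A i then ang (t j) k else 0 := by
    intro j
    apply Finset.sum_nonneg
    intro k _
    split_ifs
    · exact ang_nonneg _ _
    · rfl
  rw [← ENNReal.ofReal_sum_of_nonneg (fun j _ => mul_nonneg (by positivity) (nn j)), ← Finset.mul_sum,
    ENNReal.ofReal_eq_ofReal_iff (mul_nonneg (by positivity) (Finset.sum_nonneg fun j _ => nn j))
      (by have := ang_nonneg A i; positivity)] at this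
  have h2 : r^2/2 ≠ 0 := by positivity
  apply mul_left_cancel₀ h2
  rw [this]; ring

def stdT : Trc := ![0, 1, Complex.I]

lemma hull_vol (t : Trc) : volume (hull t) = ENNReal.ofReal |dt t| * volume (hull stdT) := by
  set M : Matrix (Fin 2) (Fin 2) ℝ := !![(t 1 - t 0).re, (t 2 - t 0).re; (t 1 - t 0).im, (t 2 - t 0).im] with hM
  set L : ℂ →ₗ[ℝ] ℂ := Matrix.toLin Complex.basisOneI Complex.basisOneI M with hL
  have hdet : LinearMap.det L = dt t := by
    rw [hL, LinearMap.det_toLin, hM, Matrix.det_fin_two_of, dt, cr]; ring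
  have hL1 : L 1 = t 1 - t 0 := by
    have := Matrix.toLin_self Complex.basisOneI Complex.basisOneI M 0
    simp only [Complex.coe_basisOneI, Fin.sum_univ_two, hM] at this
    rw [hL, hM]
    simp at this ⊢
    rw [this]
    apply Complex.ext <;> simp
  have hLI : L Complex.I = t 2 - t 0 := by
    have := Matrix.toLin_self Complex.basisOneI Complex.basisOneI M 1
    simp only [Complex.coe_basisOneI, Fin.sum_univ_two, hM] at this
    rw [hL, hM]
    simp at this ⊢
    rw [this]
    apply Complex.ext <;> simp
  have him : hull t = (fun x => t 0 + x) '' (L '' hull stdT) := by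
    have e1 : Set.range t = (fun x => t 0 + x) '' (L '' Set.range stdT) := by
      rw [← Set.range_comp, ← Set.range_comp]
      congr 1
      funext i
      fin_cases i <;> simp [stdT, hL1, hLI]
    have e2 : convexHull ℝ (L '' Set.range stdT) = L '' hull stdT := (L.image_convexHull _).symm
    rw [hull, e1, ← e2]
    simp only [Set.image_add_left]
    have := (AffineMap.image_convexHull ((AffineEquiv.constVAdd ℝ ℂ (t 0)).toAffineMap) (L '' Set.range stdT)).symm
    simpa using this
  rw [him, Set.image_add_left, measure_preimage_add, addHaar_image_linearMap, hdet]

lemma std_dt : dt stdT = 1 := by simp [dt, cr, stdT]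

lemma Til.area (H : Til N A t) : ∑ j, |dt (t j)| = |dt A| := by
  have := H.vol Set.univ MeasurableSet.univ
  simp only [Set.univ_inter] at this
  simp only [hull_vol (t _), hull_vol A] at this
  have h0 : volume (hull stdT) ≠ 0 := by
    have : (interior (hull stdT)).Nonempty := by
      rw [interior_hull _ (by rw [std_dt]; norm_num)]
      refine ⟨(1/4 : ℝ) + (1/4 : ℝ) * Complex.I, ?_⟩
      intro i
      rw [bc, std_dt]
      fin_cases i <;> simp [cr, ed, stdT] <;> norm_num
    exact (measure_pos_of_nonempty_interior _ this).ne'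
  have h1 : volume (hull stdT) ≠ ⊤ := by
    have : IsCompact (hull stdT) := (Set.finite_range _).isCompact_convexHull ℝ
    exact this.measure_lt_top.ne
  rw [← Finset.sum_mul, ENNReal.mul_left_inj h0 h1, ← ENNReal.ofReal_sum_of_nonneg (fun j _ => abs_nonneg _),
    ENNReal.ofReal_eq_ofReal_iff (Finset.sum_nonneg fun j _ => abs_nonneg _) (abs_nonneg _)] at this
  exact this

end TT
end

section
namespace TT

lemma exists_g (α : ℝ) (h : ¬ ∃ q : ℚ, α = (q : ℝ) * π) (e : ℚ) :
    ∃ g : ℝ →ₗ[ℚ] ℚ, g π = 3 ∧ g α = e := by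
  have hli : LinearIndependent ℚ ![π, α] := by
    rw [LinearIndependent.pair_iff]
    intro s r hsr
    have hsr' : (s:ℝ) * π + r * α = 0 := by simpa [Rat.smul_def] using hsr
    by_cases hr : r = 0
    · subst hr
      simp [Real.pi_ne_zero] at hsr'
      exact ⟨hsr', rfl⟩
    · exfalso
      apply h
      refine ⟨-s / r, ?_⟩
      have : (r:ℝ) ≠ 0 := by exact_mod_cast hr
      push_cast
      field_simp
      linarith
  set B := Module.Basis.span hli
  obtain ⟨g, hg⟩ := LinearMap.exists_extend (B.constr ℚ ![(3:ℚ), e])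
  refine ⟨g, ?_, ?_⟩
  · have := congrArg (fun f => f (B 0)) hg
    simp only [LinearMap.comp_apply, Module.Basis.constr_basis] at this
    simpa [B, Module.Basis.span_apply] using this
  · have := congrArg (fun f => f (B 1)) hg
    simp only [LinearMap.comp_apply, Module.Basis.constr_basis] at this
    simpa [B, Module.Basis.span_apply] using this

def chi (g : ℝ →ₗ[ℚ] ℚ) (z : ℂ) : ℝ := (-1 : ℝ) ^ ⌊g z.arg⌋

lemma chi_rel (g : ℝ →ₗ[ℚ] ℚ) (hg : g π = 3) {z w : ℂ} {s : ℝ} {n : ℤ} (hs : g s = n)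
    (h : (z.arg : Real.Angle) = (w.arg : Real.Angle) + (s : ℝ)) : chi g z = (-1) ^ n * chi g w := by
  rw [← Real.Angle.coe_add, Real.Angle.angle_eq_iff_two_pi_dvd_sub] at h
  obtain ⟨k, hk⟩ := h
  have e : z.arg = w.arg + s + ((2 * k : ℤ) : ℚ) • π := by
    rw [Rat.smul_def]; push_cast; linarith
  have e2 : g z.arg = g w.arg + ((n + 6 * k : ℤ) : ℚ) := by
    rw [e, map_add, map_add, map_smul, hs, hg, smul_eq_mul]; push_cast; ring
  rw [chi, chi, e2, Int.floor_add_intCast, zpow_add₀ (by norm_num), zpow_add₀ (by norm_num), zpow_mul]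
  norm_num
  ring

lemma chi_smul (g : ℝ →ₗ[ℚ] ℚ) (z : ℂ) (k : ℝ) (hk : 0 < k) : chi g (k * z) = chi g z := by
  rw [chi, chi, Complex.arg_real_mul _ hk]

lemma chi_neg (g : ℝ →ₗ[ℚ] ℚ) (hg : g π = 3) (z : ℂ) (hz : z ≠ 0) : chi g (-z) = -chi g z := by
  have := chi_rel g hg (s := π) (n := 3) (by simpa using hg) (Complex.arg_neg_coe_angle hz)
  rw [this]; norm_num

lemma m1_zpow_neg (n : ℤ) : (-1 : ℝ) ^ (-n) = (-1) ^ n := by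
  rw [zpow_neg, ← inv_zpow]; norm_num

lemma chi_angle (g : ℝ →ₗ[ℚ] ℚ) (hg : g π = 3) {z w : ℂ} (hz : z ≠ 0) (hw : w ≠ 0) {n : ℤ}
    (hn : g (InnerProductGeometry.angle z w) = n) : chi g z = (-1) ^ n * chi g w := by
  have h1 : (z.arg : Real.Angle) = (w.arg : Real.Angle) + ((z/w).arg : ℝ) := by
    rw [← Complex.arg_mul_coe_angle hw (by simp [hz, hw])]
    congr 2
    field_simp
  rw [Complex.angle_eq_abs_arg hz hw] at hn
  rcases abs_cases (z/w).arg with ⟨h, -⟩ | ⟨h, -⟩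
  · rw [h] at hn
    exact chi_rel g hg hn h1
  · rw [h, map_neg] at hn
    have := chi_rel g hg (n := -n) (by push_cast; linarith) h1
    rwa [m1_zpow_neg] at this

lemma chi_pm (g : ℝ →ₗ[ℚ] ℚ) (z : ℂ) : chi g z = 1 ∨ chi g z = -1 := by
  unfold chi
  rcases Int.even_or_odd ⌊g z.arg⌋ with h | h
  · left; exact h.neg_one_zpow
  · right; exact h.neg_one_zpow

def sgn (n : ℤ) : ℤ := -(-1 : ℤ) ^ n.natAbs

lemma sgn_cast (n : ℤ) : ((sgn n : ℤ) : ℝ) = -(-1 : ℝ) ^ n := by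
  unfold sgn
  rcases Int.even_or_odd n with h | h
  · rw [h.neg_one_zpow, (Int.natAbs_even.2 h).neg_one_pow]; simp
  · rw [h.neg_one_zpow, (Int.natAbs_odd.2 h).neg_one_pow]; simp

lemma dir_step (g : ℝ →ₗ[ℚ] ℚ) (hg : g π = 3) (t : Trc) (h : dt t ≠ 0) (i : Fin 3) {n : ℤ}
    (hn : g (ang t (i+2)) = n) : chi g (dir t (i+1)) = sgn n * chi g (dir t i) := by
  have hd := dir_ne t h
  have key : InnerProductGeometry.angle (dir t (i+1)) (-dir t i) = ang t (i+2) := by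
    have e1 : ed t (i+1) = t ((i+2)+1) - t (i+2) := by
      rw [ed]; simp only [add_assoc]; rfl
    have e2 : - ed t i = t ((i+2)+2) - t (i+2) := by
      rw [ed]; simp only [add_assoc]; rw [show (2:Fin 3)+2 = 1 by decide]; ring
    rw [ang, ← e1, ← e2]
    rcases lt_or_gt_of_ne h with h1 | h1
    · simp only [dir, sign_neg h1]
      simp
      rw [← InnerProductGeometry.angle_neg_neg, neg_neg]
    · simp only [dir, sign_pos h1]
      simp
  rw [← key] at hn
  rw [chi_angle g hg (hd _) (neg_ne_zero.2 (hd _)) hn, chi_neg g hg _ (hd _), sgn_cast]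
  ring

lemma per_formula (g : ℝ →ₗ[ℚ] ℚ) (hg : g π = 3) (t : Trc) (h : dt t ≠ 0) {n0 n2 : ℤ}
    (h0 : g (ang t 0) = n0) (h2 : g (ang t 2) = n2) :
    per (chi g) t = chi g (dir t 0) * (‖ed t 0‖ + sgn n2 * ‖ed t 1‖ + sgn n2 * sgn n0 * ‖ed t 2‖) := by
  have e1 : chi g (dir t 1) = sgn n2 * chi g (dir t 0) := dir_step g hg t h 0 h2
  have e2 : chi g (dir t 2) = sgn n0 * chi g (dir t 1) := dir_step g hg t h 1 h0
  rw [per, Fin.sum_univ_three, e2, e1]; ring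

structure CT (N : ℕ) (A T : Trc) (t : Fin N → Trc) : Prop extends Til N A t where
  hT : dt T ≠ 0
  cong : ∀ j i k, dist (t j i) (t j k) = dist (T i) (T k)

variable {N : ℕ} {A T : Trc} {t : Fin N → Trc}

lemma CT.ed_eq (H : CT N A T t) (j : Fin N) (i : Fin 3) : ‖ed (t j) i‖ = ‖ed T i‖ := by
  rw [ed, ed, ← dist_eq_norm, ← dist_eq_norm, H.cong]

lemma ang_cong {t T : Trc} (h : ∀ i k, dist (t i) (t k) = dist (T i) (T k)) (i : Fin 3) : ang t i = ang T i := by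
  have h1 : ‖t (i+1) - t i‖ = ‖T (i+1) - T i‖ := by rw [← dist_eq_norm, ← dist_eq_norm, h]
  have h2 : ‖t (i+2) - t i‖ = ‖T (i+2) - T i‖ := by rw [← dist_eq_norm, ← dist_eq_norm, h]
  have h3 : ‖(t (i+1) - t i) - (t (i+2) - t i)‖ = ‖(T (i+1) - T i) - (T (i+2) - T i)‖ := by
    rw [sub_sub_sub_cancel_right, sub_sub_sub_cancel_right, ← dist_eq_norm, ← dist_eq_norm, h]
  rw [ang, ang, InnerProductGeometry.angle, InnerProductGeometry.angle,
    real_inner_eq_norm_mul_self_add_norm_mul_self_sub_norm_sub_mul_self_div_two,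
    real_inner_eq_norm_mul_self_add_norm_mul_self_sub_norm_sub_mul_self_div_two, h1, h2, h3]

lemma heron (t : Trc) : 4 * dt t ^ 2 = 4 * ‖ed t 0‖^2 * ‖ed t 1‖^2 - (‖ed t 0‖^2 + ‖ed t 1‖^2 - ‖ed t 2‖^2)^2 := by
  simp only [← Complex.normSq_eq_norm_sq, Complex.normSq_apply, dt, cr, ed]
  simp
  ring

lemma CT.area (H : CT N A T t) : |dt A| = N * |dt T| := by
  rw [← H.toTil.area]
  have : ∀ j, |dt (t j)| = |dt T| := by
    intro j
    rw [← sq_eq_sq_iff_abs_eq_abs]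
    have := heron (t j)
    rw [H.ed_eq, H.ed_eq, H.ed_eq, ← heron] at this
    linarith
  simp [this]

/-- corner counts -/
def cnt (A : Trc) (t : Fin N → Trc) (i k : Fin 3) : ℕ := by
  classical exact (Finset.univ.filter (fun j => t j k = A i)).card

lemma CT.corner (H : CT N A T t) (i : Fin 3) : ang A i = ∑ k, (cnt A t i k : ℝ) * ang T k := by
  classical
  rw [H.toTil.corner_ang i, Finset.sum_comm]
  apply Finset.sum_congr rfl
  intro k _
  have : ∀ j, ang (t j) k = ang T k := fun j => ang_cong (H.cong j) k
  simp only [this, cnt]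
  rw [← Finset.sum_filter, Finset.sum_const, nsmul_eq_mul]

lemma CT.per_main (H : CT N A T t) (g : ℝ →ₗ[ℚ] ℚ) (hg : g π = 3) (e : Fin 3 → ℤ)
    (he : ∀ k, g (ang T k) = e k) : ∃ M : ℤ, |M| ≤ N ∧ M % 2 = N % 2 ∧
    ‖ed A 0‖ + (sgn (∑ k, cnt A t 2 k * e k) : ℤ) * ‖ed A 1‖
      + (sgn (∑ k, cnt A t 2 k * e k) : ℤ) * (sgn (∑ k, cnt A t 0 k * e k) : ℤ) * ‖ed A 2‖
     = M * (‖ed T 0‖ + sgn (e 2) * ‖ed T 1‖ + sgn (e 2) * sgn (e 0) * ‖ed T 2‖) := by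
  have hp := H.toTil.per_eq (chi g) (fun z _ k hk => chi_smul g z k hk) (fun z hz => chi_neg g hg z hz)
  have gA : ∀ i, g (ang A i) = ((∑ k, cnt A t i k * e k : ℤ) : ℚ) := by
    intro i
    rw [H.corner, map_sum]
    push_cast
    apply Finset.sum_congr rfl
    intro k _
    rw [← he, ← nsmul_eq_mul, map_nsmul, nsmul_eq_mul]
  have ht : ∀ j, per (chi g) (t j) = chi g (dir (t j) 0) * (‖ed T 0‖ + sgn (e 2) * ‖ed T 1‖ + sgn (e 2) * sgn (e 0) * ‖ed T 2‖) := by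
    intro j
    rw [per_formula g hg (t j) (H.ht j) (n0 := e 0) (n2 := e 2), H.ed_eq, H.ed_eq, H.ed_eq]
    · rw [ang_cong (H.cong j), he]
    · rw [ang_cong (H.cong j), he]
  rw [per_formula g hg A H.hA (gA 0) (gA 2)] at hp
  simp only [ht] at hp
  rw [← Finset.sum_mul] at hp
  have hs : ∃ s : ℤ, (s = 1 ∨ s = -1) ∧ (s : ℝ) = chi g (dir A 0) := by
    rcases chi_pm g (dir A 0) with h | h
    · exact ⟨1, by simp, by simp [h]⟩
    · exact ⟨-1, by simp, by simp [h]⟩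
  have hs2 : ∀ j, ∃ s : ℤ, (s = 1 ∨ s = -1) ∧ (s : ℝ) = chi g (dir (t j) 0) := by
    intro j
    rcases chi_pm g (dir (t j) 0) with h | h
    · exact ⟨1, by simp, by simp [h]⟩
    · exact ⟨-1, by simp, by simp [h]⟩
  obtain ⟨s, hs0, hs1⟩ := hs
  choose r hr0 hr1 using hs2
  simp only [← hr1, ← hs1] at hp
  refine ⟨s * ∑ j, r j, ?_, ?_, ?_⟩
  · have h1 : |s| = 1 := by rcases hs0 with h | h <;> simp [h]
    rw [abs_mul, h1, one_mul]
    calc |∑ j, r j| ≤ ∑ j, |r j| := Finset.abs_sum_le_sum_abs _ _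
      _ = ∑ j : Fin N, (1 : ℤ) := by
        apply Finset.sum_congr rfl
        intro j _
        rcases hr0 j with h | h <;> simp [h]
      _ = N := by simp
  · have h2 : (∑ j, r j) % 2 = N % 2 := by
      have : (∑ j, r j) ≡ ∑ j : Fin N, (1 : ℤ) [ZMOD 2] := by
        apply Int.ModEq.sum
        intro j _
        rcases hr0 j with h | h <;> simp [h]; decide
      have h3 : (∑ j, r j) ≡ N [ZMOD 2] := by simpa using this
      exact h3
    rcases hs0 with h | h <;> rw [h] <;> omega
  · have ss : (s:ℝ) * s = 1 := by rcases hs0 with h | h <;> simp [h]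
    push_cast
    linear_combination (-(s:ℝ)) * hp - (‖ed A 0‖ + (sgn (∑ k, cnt A t 2 k * e k) : ℤ) * ‖ed A 1‖
      + (sgn (∑ k, cnt A t 2 k * e k) : ℤ) * (sgn (∑ k, cnt A t 0 k * e k) : ℤ) * ‖ed A 2‖) * ss

end TT
end

section
namespace TT
variable {N : ℕ} {A T : Trc} {t : Fin N → Trc}

lemma abs_cr (x y : ℂ) : |cr x y| = Real.sin (InnerProductGeometry.angle x y) * (‖x‖ * ‖y‖) := by
  rw [InnerProductGeometry.sin_angle_mul_norm_mul_norm]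
  rw [← Real.sqrt_sq_eq_abs]
  congr 1
  simp [cr, Complex.inner]
  have hx := Complex.normSq_eq_norm_sq x
  have hy := Complex.normSq_eq_norm_sq y
  rw [Complex.normSq_apply] at hx hy
  linear_combination (y.re * y.re + y.im * y.im) * hx + ‖x‖^2 * hy

lemma nrm1 (t : Trc) (i : Fin 3) : ‖t (i+1) - t i‖ = ‖ed t (i+2)‖ := by
  rw [ed, add_assoc, add_assoc, show (2:Fin 3) + 2 = 1 by decide, show (2:Fin 3)+1 = 0 by decide, add_zero]

lemma nrm2 (t : Trc) (i : Fin 3) : ‖t (i+2) - t i‖ = ‖ed t (i+1)‖ := by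
  rw [ed, add_assoc, add_assoc, show (1:Fin 3) + 2 = 0 by decide, show (1:Fin 3)+1 = 2 by decide, add_zero, norm_sub_rev]

lemma area_sin (t : Trc) (i : Fin 3) : |dt t| = Real.sin (ang t i) * (‖ed t (i+1)‖ * ‖ed t (i+2)‖) := by
  rw [← cr_dt t i, abs_cr, nrm1, nrm2, ang]; ring

lemma cos_law (t : Trc) (i : Fin 3) :
    ‖ed t i‖^2 = ‖ed t (i+1)‖^2 + ‖ed t (i+2)‖^2 - 2 * (‖ed t (i+1)‖ * ‖ed t (i+2)‖) * Real.cos (ang t i) := by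
  have h := InnerProductGeometry.norm_sub_sq_eq_norm_sq_add_norm_sq_sub_two_mul_norm_mul_norm_mul_cos_angle (t (i+1) - t i) (t (i+2) - t i)
  rw [sub_sub_sub_cancel_right, nrm1, nrm2, norm_sub_rev] at h
  rw [ed, ang]
  nlinarith [h]

lemma ang_sum (t : Trc) (h : dt t ≠ 0) : ang t 0 + ang t 1 + ang t 2 = π := by
  have h1 : t 1 ≠ t 0 := fun e => by simpa using vert_inj t h e
  have h2 : t 2 ≠ t 0 := fun e => by simpa using vert_inj t h e
  have := angle_add_angle_add_angle_eq_pi (p₁ := t 0) (p₂ := t 1) (t 2) (by tauto)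
  simp only [EuclideanGeometry.angle, vsub_eq_sub] at this
  have e0 : ang t 0 = InnerProductGeometry.angle (t 2 - t 0) (t 1 - t 0) := by
    rw [InnerProductGeometry.angle_comm]; rfl
  have e1 : ang t 1 = InnerProductGeometry.angle (t 0 - t 1) (t 2 - t 1) := by
    rw [InnerProductGeometry.angle_comm]; rfl
  have e2 : ang t 2 = InnerProductGeometry.angle (t 1 - t 2) (t 0 - t 2) := by
    rw [InnerProductGeometry.angle_comm]; rfl
  linarith

lemma ed_pos (t : Trc) (h : dt t ≠ 0) (i : Fin 3) : 0 < ‖ed t i‖ := norm_pos_iff.2 (ed_ne t h i)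

lemma ang_pos (t : Trc) (h : dt t ≠ 0) (i : Fin 3) : 0 < ang t i := by
  have h0 := area_sin t i
  have : 0 < |dt t| := abs_pos.2 h
  rcases (ang_nonneg t i).lt_or_eq with h1 | h1
  · exact h1
  · rw [← h1] at h0; simp at h0; exact absurd h0 h

structure Tile (α β a b c : ℝ) : Prop where
  a0 : 0 < a
  b0 : 0 < b
  c0 : 0 < c
  cc : c^2 = a^2 + a*b + b^2
  ab : a ≠ b
  sum : α + β = π / 3
  sa : Real.sin α = √3 * a / (2 * c)
  sb : Real.sin β = √3 * b / (2 * c)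
  ca : Real.cos α = (2*b+a) / (2 * c)
  cb : Real.cos β = (2*a+b) / (2 * c)

lemma tile_of (T : Trc) (h : dt T ≠ 0) (hirr : ¬ ∃ q : ℚ, ang T 0 = (q : ℝ) * π) (hg : ang T 2 = 2 * π / 3) :
    Tile (ang T 0) (ang T 1) ‖ed T 0‖ ‖ed T 1‖ ‖ed T 2‖ := by
  have a0 := ed_pos T h 0
  have b0 := ed_pos T h 1
  have c0 := ed_pos T h 2
  have hs := ang_sum T h
  have sg : Real.sin (2*π/3) = √3 / 2 := by
    rw [show 2 * π / 3 = π - π/3 by ring, Real.sin_pi_sub, Real.sin_pi_div_three]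
  have cg : Real.cos (2*π/3) = -(1/2) := by
    rw [show 2 * π / 3 = π - π/3 by ring, Real.cos_pi_sub, Real.cos_pi_div_three]
  have A0 := area_sin T 0
  have A1 := area_sin T 1
  have A2 := area_sin T 2
  have C0 := cos_law T 0
  have C1 := cos_law T 1
  have C2 := cos_law T 2
  simp only [show (0:Fin 3)+1 = 1 by decide, show (0:Fin 3)+2 = 2 by decide, show (1:Fin 3)+1 = 2 by decide,
    show (1:Fin 3)+2 = 0 by decide, show (2:Fin 3)+1 = 0 by decide, show (2:Fin 3)+2 = 1 by decide] at A0 A1 A2 C0 C1 C2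
  rw [hg, sg] at A2
  rw [hg, cg] at C2
  set a := ‖ed T 0‖
  set b := ‖ed T 1‖
  set c := ‖ed T 2‖
  have cc : c^2 = a^2 + a*b + b^2 := by nlinarith
  have ca : Real.cos (ang T 0) = (2*b+a) / (2 * c) := by
    rw [eq_div_iff (by positivity)]
    apply mul_left_cancel₀ b0.ne'
    nlinarith
  have cb : Real.cos (ang T 1) = (2*a+b) / (2 * c) := by
    rw [eq_div_iff (by positivity)]
    apply mul_left_cancel₀ a0.ne'
    nlinarith
  refine ⟨a0, b0, c0, cc, ?_, by linarith, ?_, ?_, ca, cb⟩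
  · intro hab
    apply hirr
    refine ⟨1/6, ?_⟩
    have : Real.cos (ang T 0) = Real.cos (ang T 1) := by rw [ca, cb, hab]
    have := Real.injOn_cos ⟨ang_nonneg T 0, InnerProductGeometry.angle_le_pi _ _⟩ ⟨ang_nonneg T 1, InnerProductGeometry.angle_le_pi _ _⟩ this
    push_cast
    linarith
  · rw [eq_div_iff (by positivity)]
    apply mul_left_cancel₀ b0.ne'
    linear_combination 2 * A2 - 2 * A0
  · rw [eq_div_iff (by positivity)]
    apply mul_left_cancel₀ a0.ne'
    linear_combination 2 * A2 - 2 * A1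

/-- normalized sine -/
def xs (c θ : ℝ) : ℝ := 2 * c / √3 * Real.sin θ

lemma Tile.x_a {α β a b c : ℝ} (h : Tile α β a b c) : xs c α = a := by
  have := h.c0
  rw [xs, h.sa]; field_simp

lemma Tile.swap {α β a b c : ℝ} (h : Tile α β a b c) : Tile β α b a c :=
  ⟨h.b0, h.a0, h.c0, by rw [h.cc]; ring, h.ab.symm, by rw [add_comm]; exact h.sum, h.sb, h.sa, h.cb, h.ca⟩

lemma Tile.x_ab {α β a b c : ℝ} (h : Tile α β a b c) : xs c (α + β) = c := by
  rw [xs, h.sum, Real.sin_pi_div_three]; field_simp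

lemma Tile.x_2a {α β a b c : ℝ} (h : Tile α β a b c) : xs c (2 * α) = a * (2 * b + a) / c := by
  have := h.c0
  rw [xs, Real.sin_two_mul, h.sa, h.ca]; field_simp

lemma Tile.x_3a {α β a b c : ℝ} (h : Tile α β a b c) : xs c (3 * α) = 3 * a * b * (a + b) / c^2 := by
  have := h.c0
  have h3 : √3^2 = 3 := Real.sq_sqrt (by norm_num)
  rw [xs, Real.sin_three_mul, h.sa]; field_simp
  rw [h3, h.cc]; ring

lemma Tile.x_3b {α β a b c : ℝ} (h : Tile α β a b c) : xs c (3 * β) = 3 * a * b * (a + b) / c^2 := by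
  rw [h.swap.x_3a]; ring

lemma Tile.x_a3b {α β a b c : ℝ} (h : Tile α β a b c) : xs c (α + 3 * β) = a * (2 * b + a) / c := by
  rw [← h.x_2a, xs, xs, show α + 3 * β = π - 2 * α by linarith [h.sum], Real.sin_pi_sub]

lemma Tile.x_a2b {α β a b c : ℝ} (h : Tile α β a b c) : xs c (α + 2 * β) = a + b := by
  have := h.c0
  have h3 : √3^2 = 3 := Real.sq_sqrt (by norm_num)
  rw [xs, show α + 2 * β = π / 3 + β by linarith [h.sum], Real.sin_add, Real.sin_pi_div_three, Real.cos_pi_div_three, h.sb, h.cb]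
  field_simp; ring

lemma Tile.x_2ab {α β a b c : ℝ} (h : Tile α β a b c) : xs c (2 * α + β) = a + b := by
  rw [add_comm, h.swap.x_a2b, add_comm]

lemma CT.sines (H : CT N A T t) (hirr : ¬ ∃ q : ℚ, ang T 0 = (q : ℝ) * π) (hg : ang T 2 = 2 * π / 3) :
    ∃ D > 0, (∀ i, ‖ed A i‖ = D * xs ‖ed T 2‖ (ang A i)) ∧
      N * (‖ed T 0‖ * ‖ed T 1‖ * ‖ed T 2‖) = D^2 * (xs ‖ed T 2‖ (ang A 0) * xs ‖ed T 2‖ (ang A 1) * xs ‖ed T 2‖ (ang A 2)) := by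
  have hT := tile_of T H.hT hirr hg
  have A0 := area_sin A 0
  have A1 := area_sin A 1
  have A2 := area_sin A 2
  have B0 := area_sin T 0
  have hN := H.area
  simp only [show (0:Fin 3)+1 = 1 by decide, show (0:Fin 3)+2 = 2 by decide, show (1:Fin 3)+1 = 2 by decide,
    show (1:Fin 3)+2 = 0 by decide, show (2:Fin 3)+1 = 0 by decide, show (2:Fin 3)+2 = 1 by decide] at A0 A1 A2 B0
  rw [hT.sa] at B0
  have l0 := ed_pos A H.hA 0
  have l1 := ed_pos A H.hA 1
  have l2 := ed_pos A H.hA 2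
  have hd : 0 < |dt A| := abs_pos.2 H.hA
  set L0 := ‖ed A 0‖
  set L1 := ‖ed A 1‖
  set L2 := ‖ed A 2‖
  obtain ⟨a0, b0, c0, cc, -⟩ := hT
  set a := ‖ed T 0‖
  set b := ‖ed T 1‖
  set c := ‖ed T 2‖
  set Δ := |dt A|
  have s3 : 0 < √3 := by positivity
  have h3 : √3^2 = 3 := Real.sq_sqrt (by norm_num)
  have S0 : Real.sin (ang A 0) = Δ / (L1 * L2) := by rw [eq_div_iff (by positivity)]; linarith
  have S1 : Real.sin (ang A 1) = Δ / (L2 * L0) := by rw [eq_div_iff (by positivity)]; linarith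
  have S2 : Real.sin (ang A 2) = Δ / (L0 * L1) := by rw [eq_div_iff (by positivity)]; linarith
  refine ⟨L0 * L1 * L2 / Δ * (√3 / (2 * c)), by positivity, ?_, ?_⟩
  · intro i
    fin_cases i
    · simp only [xs]; simp; rw [S0]; field_simp; rfl
    · simp only [xs]; simp; rw [S1]; field_simp; rfl
    · simp only [xs]; simp; rw [S2]; field_simp; rfl
  · simp only [xs, S0, S1, S2]
    field_simp
    rw [hN, B0]
    field_simp

lemma CT.p1 (H : CT N A T t) (hirr : ¬ ∃ q : ℚ, ang T 0 = (q : ℝ) * π) (hg : ang T 2 = 2 * π / 3) (hk : ∀ i, cnt A t i 2 = 0) :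
    ∃ M : ℤ, |M| ≤ N ∧ M % 2 = N % 2 ∧
    ‖ed A 0‖ + sgn (cnt A t 2 1) * ‖ed A 1‖ + sgn (cnt A t 2 1) * sgn (cnt A t 0 1) * ‖ed A 2‖
     = M * (‖ed T 2‖ + ‖ed T 0‖ - ‖ed T 1‖) := by
  obtain ⟨g, g1, g2⟩ := exists_g _ hirr 0
  have e2 : g (ang T 2) = 2 := by
    rw [hg, show 2 * π / 3 = (2/3 : ℚ) • π by rw [Rat.smul_def]; push_cast; ring, map_smul, g1]; norm_num
  have hs := congrArg g (ang_sum T H.hT)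
  rw [map_add, map_add, e2, g1, g2] at hs
  obtain ⟨M, h1, h2, h3⟩ := H.per_main g g1 ![0, 1, 2] (by
    intro k; fin_cases k
    · simpa using g2
    · simp; linarith
    · simpa using e2)
  refine ⟨M, h1, h2, ?_⟩
  simp [Fin.sum_univ_three, hk] at h3
  rw [h3, show sgn 2 = -1 by decide, show sgn 0 = -1 by decide]
  push_cast; ring

lemma CT.p2 (H : CT N A T t) (hirr : ¬ ∃ q : ℚ, ang T 0 = (q : ℝ) * π) (hg : ang T 2 = 2 * π / 3) (hk : ∀ i, cnt A t i 2 = 0) :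
    ∃ M : ℤ, |M| ≤ N ∧ M % 2 = N % 2 ∧
    ‖ed A 0‖ + sgn (cnt A t 2 0) * ‖ed A 1‖ + sgn (cnt A t 2 0) * sgn (cnt A t 0 0) * ‖ed A 2‖
     = M * (‖ed T 2‖ + ‖ed T 1‖ - ‖ed T 0‖) := by
  obtain ⟨g, g1, g2⟩ := exists_g _ hirr 1
  have e2 : g (ang T 2) = 2 := by
    rw [hg, show 2 * π / 3 = (2/3 : ℚ) • π by rw [Rat.smul_def]; push_cast; ring, map_smul, g1]; norm_num
  have hs := congrArg g (ang_sum T H.hT)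
  rw [map_add, map_add, e2, g1, g2] at hs
  obtain ⟨M, h1, h2, h3⟩ := H.per_main g g1 ![1, 0, 2] (by
    intro k; fin_cases k
    · simpa using g2
    · simp; linarith
    · simpa using e2)
  refine ⟨-M, by rwa [abs_neg], by omega, ?_⟩
  simp [Fin.sum_univ_three, hk] at h3
  rw [h3, show sgn 2 = -1 by decide, show sgn 1 = 1 by decide]
  push_cast; ring

lemma CT.totals (H : CT N A T t) (hirr : ¬ ∃ q : ℚ, ang T 0 = (q : ℝ) * π) (hg : ang T 2 = 2 * π / 3) :
    (∑ i, cnt A t i 1) + 2 * ∑ i, cnt A t i 2 = 3 ∧ (∑ i, cnt A t i 0) + 2 * ∑ i, cnt A t i 2 = 3 := by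
  have hA := ang_sum A H.hA
  have key : ∀ e : ℚ, ∑ i, (cnt A t i 0 * e + cnt A t i 1 * (1 - e) + cnt A t i 2 * 2) = 3 := by
    intro e
    obtain ⟨g, g1, g2⟩ := exists_g _ hirr e
    have e2 : g (ang T 2) = 2 := by
      rw [hg, show 2 * π / 3 = (2/3 : ℚ) • π by rw [Rat.smul_def]; push_cast; ring, map_smul, g1]; norm_num
    have hs := congrArg g (ang_sum T H.hT)
    rw [map_add, map_add, e2, g1, g2] at hs
    have e1 : g (ang T 1) = 1 - e := by linarith
    have gA : ∀ i, g (ang A i) = cnt A t i 0 * e + cnt A t i 1 * (1 - e) + cnt A t i 2 * 2 := by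
      intro i
      rw [H.corner, map_sum, Fin.sum_univ_three]
      simp only [← nsmul_eq_mul, map_nsmul, e1, e2, g2]
    have := congrArg g hA
    rw [map_add, map_add, g1, gA, gA, gA] at this
    rw [Fin.sum_univ_three]; exact this
  have k0 := key 0
  have k1 := key 1
  simp only [Fin.sum_univ_three] at k0 k1 ⊢
  constructor
  · have : ((cnt A t 0 1 + cnt A t 1 1 + cnt A t 2 1 + 2 * (cnt A t 0 2 + cnt A t 1 2 + cnt A t 2 2) : ℕ) : ℚ) = (3 : ℕ) := by
      push_cast; linarith
    exact_mod_cast this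
  · have : ((cnt A t 0 0 + cnt A t 1 0 + cnt A t 2 0 + 2 * (cnt A t 0 2 + cnt A t 1 2 + cnt A t 2 2) : ℕ) : ℚ) = (3 : ℕ) := by
      push_cast; linarith
    exact_mod_cast this

lemma CT.row_ne (H : CT N A T t) (i : Fin 3) : cnt A t i 0 + cnt A t i 1 + cnt A t i 2 ≠ 0 := by
  intro h
  have := H.corner i
  have h0 : cnt A t i 0 = 0 := by omega
  have h1 : cnt A t i 1 = 0 := by omega
  have h2 : cnt A t i 2 = 0 := by omega
  rw [Fin.sum_univ_three, h0, h1, h2] at this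
  have := ang_pos A H.hA i
  simp at *; linarith

open Classical in
lemma CT.comb (H : CT N A T t) (k : Fin 3) : ∃ n : Fin 3 → ℕ,
    ‖ed A k‖ = n 0 * ‖ed T 0‖ + n 1 * ‖ed T 1‖ + n 2 * ‖ed T 2‖ ∧ ∀ p, onS A t k p → n p.2 ≠ 0 := by
  refine ⟨fun i => (Finset.univ.filter (fun p : Fin N × Fin 3 => onS A t k p ∧ p.2 = i)).card, ?_, ?_⟩
  · rw [← H.toTil.side_len k]
    simp only [H.ed_eq]
    have : ∀ p : Fin N × Fin 3, ‖ed T p.2‖ = ∑ i, if p.2 = i then ‖ed T i‖ else 0 := by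
      intro p; simp
    rw [Finset.sum_congr rfl (fun p _ => this p), Finset.sum_comm]
    simp only [← Finset.sum_filter, Finset.filter_filter, Finset.sum_const, nsmul_eq_mul]
    rw [Fin.sum_univ_three]
  · intro p hp
    apply Finset.card_ne_zero_of_mem (a := p)
    simp [hp]

end TT
end

section
namespace TT

lemma nonsq {x y Q : ℤ} (hQ : ¬ IsSquare Q) (h : x^2 * Q = y^2) : x = 0 := by
  by_contra hx
  have h1 : x^2 ∣ y^2 := ⟨Q, h.symm⟩
  rw [Int.pow_dvd_pow_iff (by norm_num)] at h1
  obtain ⟨z, rfl⟩ := h1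
  apply hQ
  refine ⟨z, ?_⟩
  have : x^2 ≠ 0 := by positivity
  apply mul_left_cancel₀ this
  rw [h]; ring

section
variable {α β a b c : ℝ}

lemma Tile.u0 (h : Tile α β a b c) : 0 < c + a - b := by
  obtain ⟨a0, b0, c0, cc, -⟩ := h
  nlinarith [mul_pos a0 b0]

lemma Tile.v0 (h : Tile α β a b c) : 0 < c + b - a := by
  obtain ⟨a0, b0, c0, cc, -⟩ := h
  nlinarith [mul_pos a0 b0]

lemma Tile.uv (h : Tile α β a b c) : (c + a - b) * (c + b - a) = 3 * (a * b) := by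
  linear_combination h.cc

lemma pos_int {M : ℤ} {u : ℝ} (hu : 0 < u) (h : 0 < M * u) : 0 < M := by
  have := pos_of_mul_pos_left h hu.le
  exact_mod_cast this

lemma alg2 (h : Tile α β a b c) {N : ℕ} {M M' : ℤ} {E : ℝ} (hE : 0 < E) (hM' : |M'| ≤ N)
    (e1 : E * (2 * c - (2 * b + a)) = M * (c + a - b)) (e2 : E * (2 * c + (2 * b + a)) = M' * (c + b - a)) : 12 ≤ N := by
  have u0 := h.u0
  have v0 := h.v0
  obtain ⟨a0, b0, c0, cc, -⟩ := h
  have q : 0 < 2 * c - (2 * b + a) := by nlinarith [mul_pos a0 b0]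
  have m0 : 0 < M := pos_int u0 (e1 ▸ mul_pos hE q)
  have m0' : 1 ≤ (M:ℝ) := by exact_mod_cast m0
  have key : (M:ℝ) * (a + b + c) = M' * (a + b - c) := by
    have h3 : 3 * a * E ≠ 0 := by positivity
    apply mul_left_cancel₀ h3
    linear_combination (-E) * (2 * c + (2 * b + a)) * e1 + E * (2 * c - (2 * b + a)) * e2 + 2 * E * (M' - M) * cc
  have d0 : 0 < a + b - c := by nlinarith [mul_pos a0 b0]
  have d1 : 12 * (a + b - c) ≤ a + b + c := by
    nlinarith [mul_pos a0 b0, sq_nonneg (a - b), sq_nonneg (a+b)]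
  have : (12:ℝ) ≤ M' := by
    by_contra hc
    push Not at hc
    nlinarith
  have : 12 ≤ M' := by exact_mod_cast this
  have := le_abs_self M'
  omega

lemma algE_dec : ∀ N M M' : Fin 12, 0 < N.1 ∧ M.1 * M'.1 = 3 * N.1 ∧ M.1 ≤ N.1 ∧ M'.1 ≤ N.1 ∧ M.1 % 2 = N.1 % 2 ∧ M'.1 % 2 = N.1 % 2 ∧ M.1 ≠ M'.1 →
    ¬ IsSquare ((M.1 + M'.1)^2 + 4 * N.1) ∧ ∀ r : Fin 12, r.1 * (M.1 + M'.1) ≠ 2 * N.1 := by decide +kernel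

lemma algE (h : Tile α β a b c) {N : ℕ} (hN : N < 12) {M M' : ℤ} {X : ℝ} (hX : 0 < X) (hM : |M| ≤ N) (hM' : |M'| ≤ N)
    (pM : M % 2 = N % 2) (pM' : M' % 2 = N % 2)
    (e1 : 3 * X = M * (c + a - b)) (e2 : 3 * X = M' * (c + b - a)) (hNX : N * (a * b) = X^2)
    {p q r : ℕ} (hc : X = p * a + q * b + r * c) : False := by
  have u0 := h.u0
  have v0 := h.v0
  have uv := h.uv
  obtain ⟨a0, b0, c0, cc, ab, -⟩ := h
  have m0 : 0 < M := pos_int u0 (e1 ▸ by positivity)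
  have m0' : 0 < M' := pos_int v0 (e2 ▸ by positivity)
  have K : M * M' = 3 * N := by
    have : (M:ℝ) * M' = 3 * N := by
      have h3 : 3 * (a * b) ≠ 0 := by positivity
      apply mul_left_cancel₀ h3
      linear_combination (-(M:ℝ) * M') * uv - (M' * (c + b - a)) * e1 - 3 * X * e2 - 9 * hNX
    exact_mod_cast this
  have ne : M ≠ M' := by
    rintro rfl
    have : (M:ℝ) ≠ 0 := by exact_mod_cast m0.ne'
    apply ab
    have := mul_left_cancel₀ this (e1.symm.trans e2)
    linarith
  have Nr : (M:ℝ) * M' = 3 * N := by exact_mod_cast K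
  have f1 : 2 * N * c = X * (M + M') := by
    linear_combination (-2/3 * c) * Nr - (M'/3 : ℝ) * e1 - (M/3:ℝ) * e2
  have f2 : 2 * N * (a - b) = X * (M' - M) := by
    linear_combination (-2/3 * (a-b)) * Nr - (M'/3 : ℝ) * e1 + (M/3:ℝ) * e2
  have f3 : (2 * N * (a + b))^2 = X^2 * ((M + M')^2 + 4 * N) := by
    linear_combination 4 * N * hNX + (2 * N * c + X * (M + M')) * f1 - 4 * N^2 * cc
  have f4 : ((p:ℝ) + q) * (2 * N * (a + b)) = X * (4 * N - (p - q) * (M' - M) - 2 * r * (M + M')) := by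
    linear_combination (-4 * N) * hc - (p - q) * f2 - 2 * r * f1
  have f5 : ((p:ℤ) + q)^2 * ((M + M')^2 + 4 * N) = (4 * N - (p - q) * (M' - M) - 2 * r * (M + M'))^2 := by
    have : ((p:ℝ) + q)^2 * ((M + M')^2 + 4 * N) = (4 * N - (p - q) * (M' - M) - 2 * r * (M + M'))^2 := by
      have h3 : X^2 ≠ 0 := by positivity
      apply mul_left_cancel₀ h3
      linear_combination (-((p:ℝ)+q)^2) * f3 + (((p:ℝ) + q) * (2 * N * (a + b)) + X * (4 * N - (p - q) * (M' - M) - 2 * r * (M + M'))) * f4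
    exact_mod_cast this
  lift M to ℕ using m0.le
  lift M' to ℕ using m0'.le
  have hM : M ≤ N := by have := le_abs_self (M:ℤ); omega
  have hM' : M' ≤ N := by have := le_abs_self (M':ℤ); omega
  have D := algE_dec ⟨N, hN⟩ ⟨M, by omega⟩ ⟨M', by omega⟩ ⟨by dsimp only; omega, by exact_mod_cast K, hM, hM', by dsimp only; omega, by dsimp only; omega, by exact_mod_cast ne⟩
  have s := nonsq (by
    have := D.1
    intro hc
    apply this
    obtain ⟨z, hz⟩ := hc
    refine ⟨z.natAbs, ?_⟩
    zify
    rw [← abs_mul, ← hz]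
    exact (abs_of_nonneg (by positivity)).symm) f5
  have p0 : p = 0 := by omega
  have q0 : q = 0 := by omega
  subst p0 q0
  have g : r * ((M:ℝ) + M') = 2 * N := by
    apply mul_left_cancel₀ hX.ne'
    simp at hc
    push_cast at f1
    linear_combination (-r : ℝ) * f1 - 2 * N * hc
  have g' : r * (M + M') = 2 * N := by exact_mod_cast g
  apply D.2 ⟨r, ?_⟩ g'
  by_contra hr
  push Not at hr
  have : 0 < M := by omega
  nlinarith

lemma alg3_dec : ∀ N M M' : Fin 12, 0 < M.1 ∧ M.1 * M'.1 = N.1 ∧ M.1 < M'.1 ∧ M.1 % 2 = N.1 % 2 ∧ M'.1 % 2 = N.1 % 2 →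
    ¬ IsSquare (M.1^2 + 14 * N.1 + M'.1^2) := by decide +kernel

lemma alg3 (h : Tile α β a b c) {N : ℕ} (hN : N < 12) {M M' : ℤ} {D : ℝ} (hD : 0 < D) (hM : |M| ≤ N) (hM' : |M'| ≤ N)
    (pM : M % 2 = N % 2) (pM' : M' % 2 = N % 2)
    (e1 : D * (2 * a + b - c) = M * (c + a - b)) (e2 : D * (2 * a + b + c) = M' * (c + b - a)) (hND : N * b = D^2 * (a + b))
    {p q r : ℕ} (hc : D * c = p * a + q * b + r * c ∨ D * a = p * a + q * b + r * c) : p = 0 ∧ r = 0 := by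
  have u0 := h.u0
  have v0 := h.v0
  have uv := h.uv
  obtain ⟨a0, b0, c0, cc, ab, -⟩ := h
  have q0 : 0 < 2 * a + b - c := by nlinarith [mul_pos a0 b0]
  have m0 : 0 < M := pos_int u0 (e1 ▸ by positivity)
  have m0' : 0 < M' := pos_int v0 (e2 ▸ by positivity)
  have K : M * M' = N := by
    have : (M:ℝ) * M' = N := by
      have h3 : 3 * (a * b) ≠ 0 := by positivity
      apply mul_left_cancel₀ h3
      linear_combination (-(M:ℝ) * M') * uv - (M' * (c + b - a)) * e1 - D * (2 * a + b - c) * e2 - 3 * a * hND - D^2 * cc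
    exact_mod_cast this
  have f1 : c * (M' - M) = a * ((M:ℝ) + M') := by
    have h3 : 3 * a * D ≠ 0 := by positivity
    apply mul_left_cancel₀ h3
    linear_combination D * (2 * a + b + c) * e1 - D * (2 * a + b - c) * e2 + D * (M + M') * cc
  have lt : M < M' := by
    have : 0 < c * ((M':ℝ) - M) := by rw [f1]; positivity
    have := pos_of_mul_pos_right this c0.le
    have : (M:ℝ) < M' := by linarith
    exact_mod_cast this
  have Nr : (M:ℝ) * M' = N := by exact_mod_cast K
  have f2 : 2 * (D * c) = ((M:ℝ) + M') * b := by linear_combination e2 - e1 + f1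
  have f3 : 2 * (D * a) = ((M':ℝ) - M) * b := by
    apply mul_left_cancel₀ c0.ne'
    linear_combination a * f2 - b * f1
  have f4 : ((2 * b + a) * ((M:ℝ) + M'))^2 = c^2 * (M^2 + 14 * N + M'^2) := by
    linear_combination (-4 * (M + M')^2) * cc + 3 * (c * (M' - M) + a * ((M:ℝ) + M')) * f1 + 14 * c^2 * Nr
  have hsq : ¬ IsSquare (M^2 + 14 * N + M'^2) := by
    lift M to ℕ using m0.le
    lift M' to ℕ using m0'.le
    have hM : M ≤ N := by have := le_abs_self (M:ℤ); omega
    have hM' : M' ≤ N := by have := le_abs_self (M':ℤ); omega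
    have D := alg3_dec ⟨N, hN⟩ ⟨M, by omega⟩ ⟨M', by omega⟩ ⟨by dsimp only; omega, by exact_mod_cast K, by dsimp only; omega, by dsimp only; omega, by dsimp only; omega⟩
    intro hc
    apply D
    obtain ⟨z, hz⟩ := hc
    refine ⟨z.natAbs, ?_⟩
    zify
    rw [← abs_mul, ← hz]
    exact (abs_of_nonneg (by positivity)).symm
  have hk : ∃ k : ℤ, 2 * ((p:ℝ) * a + q * b + r * c) = k * b := by
    rcases hc with hc | hc
    · exact ⟨M + M', by rw [← hc, f2]; push_cast; ring⟩
    · exact ⟨M' - M, by rw [← hc, f3]; push_cast; ring⟩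
  obtain ⟨k, hk⟩ := hk
  have f5 : ((k:ℝ) - 2 * q) * ((2 * b + a) * ((M:ℝ) + M')) = c * (4 * p * (M' - M) + 4 * r * (M + M') + (k - 2 * q) * (M' - M)) := by
    linear_combination (-2 * ((M:ℝ) + M')) * hk - (4 * p + (k - 2 * q)) * f1
  have f6 : (k - 2 * q)^2 * (M^2 + 14 * N + M'^2) = (4 * p * (M' - M) + 4 * r * (M + M') + (k - 2 * q) * (M' - M))^2 := by
    have : ((k:ℝ) - 2 * q)^2 * (M^2 + 14 * N + M'^2) = (4 * p * (M' - M) + 4 * r * (M + M') + (k - 2 * q) * (M' - M))^2 := by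
      have h3 : c^2 ≠ 0 := by positivity
      apply mul_left_cancel₀ h3
      linear_combination (-((k:ℝ) - 2 * q)^2) * f4 + (((k:ℝ) - 2 * q) * ((2 * b + a) * ((M:ℝ) + M')) + c * (4 * p * (M' - M) + 4 * r * (M + M') + (k - 2 * q) * (M' - M))) * f5
    exact_mod_cast this
  have s := nonsq hsq f6
  rw [s] at f6
  have f7 : 4 * p * (M' - M) + 4 * r * (M + M') = 0 := by
    have : (4 * p * (M' - M) + 4 * r * (M + M'))^2 = 0 := by linear_combination -f6
    exact pow_eq_zero_iff (by norm_num) |>.1 this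
  have t1 : 0 ≤ (p:ℤ) * (M' - M) := mul_nonneg (by positivity) (by linarith)
  have t2 : 0 ≤ (r:ℤ) * (M + M') := mul_nonneg (by positivity) (by linarith)
  have t3 : (p:ℤ) * (M' - M) = 0 := by linarith
  have t4 : (r:ℤ) * (M + M') = 0 := by linarith
  constructor
  · rcases mul_eq_zero.1 t3 with h | h
    · exact_mod_cast h
    · omega
  · rcases mul_eq_zero.1 t4 with h | h
    · exact_mod_cast h
    · omega

lemma alg4_dec : ∀ N M M' : Fin 12, M.1 * M'.1 < N.1 ∧ 0 < M.1 ∧ 0 < M'.1 ∧ M.1 % 2 = N.1 % 2 ∧ M'.1 % 2 = N.1 % 2 →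
    ((M'.1:ℤ) - M.1)^2 * ((N.1:ℤ) + 3 * (M.1 * M'.1))^2 ≠ ((M'.1:ℤ) + M.1)^2 * ((N.1:ℤ)^2 + 3 * (M.1 * M'.1)^2) := by decide +kernel

lemma alg5_dec : ∀ N M M' : Fin 12, M.1 * M'.1 < N.1 ∧ 0 < M.1 ∧ 0 < M'.1 ∧ M.1 % 2 = N.1 % 2 ∧ M'.1 % 2 = N.1 % 2 →
    ((M'.1:ℤ) - M.1)^2 * ((N.1:ℤ)^2 + 3 * (M.1 * M'.1)^2) ≠ ((M'.1:ℤ) + M.1)^2 * ((N.1:ℤ) - M.1 * M'.1)^2 := by decide +kernel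

lemma two_pos {M M' : ℤ} {u v : ℝ} (hu : 0 < u) (hv : 0 < v) (hK : 0 < M * M') (h : 0 < M * u + M' * v) : 0 < M ∧ 0 < M' := by
  rcases pos_and_pos_or_neg_and_neg_of_mul_pos hK with h1 | h1
  · exact h1
  · exfalso
    have a1 : (M:ℝ) < 0 := by exact_mod_cast h1.1
    have a2 : (M':ℝ) < 0 := by exact_mod_cast h1.2
    nlinarith [mul_pos_of_neg_of_neg a1 (neg_neg_of_pos hu), mul_pos_of_neg_of_neg a2 (neg_neg_of_pos hv)]

lemma alg4 (h : Tile α β a b c) {N : ℕ} (hN : N < 12) {M M' : ℤ} {E : ℝ} (hE : 0 < E) (hM : |M| ≤ N) (hM' : |M'| ≤ N)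
    (pM : M % 2 = N % 2) (pM' : M' % 2 = N % 2)
    (e1 : E * (c^2 + (2 * b + a) * c - 3 * b * (a + b)) = M * (c + a - b))
    (e2 : E * ((2 * b + a) * c + 3 * b * (a + b) - c^2) = M' * (c + b - a)) (hNE : N = 3 * E^2 * ((2 * b + a) * (a + b))) : False := by
  have u0 := h.u0
  have v0 := h.v0
  have uv := h.uv
  obtain ⟨a0, b0, c0, cc, ab, -⟩ := h
  have K : (M * M' : ℝ) * (a + 2 * b) = N * a := by
    have h3 : 3 * (a * b) ≠ 0 := by positivity
    apply mul_left_cancel₀ h3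
    rw [hNE]
    have k1 : (M * M' : ℝ) * (3 * (a * b)) = E^2 * (9 * a^2 * b * (a + b)) := by
      rw [← uv]
      have : (M * M' : ℝ) * ((c + a - b) * (c + b - a)) = (M * (c + a - b)) * (M' * (c + b - a)) := by ring
      rw [this, ← e1, ← e2]
      have : c^4 = (a^2+a*b+b^2)^2 := by rw [← cc]; ring
      linear_combination (E^2 * ((2 * b + a)^2 + 6 * b * (a + b)))* cc - E^2 * this
    linear_combination (a + 2 * b) * k1
  have K0 : 0 < M * M' := by
    have : 0 < (M * M' : ℝ) * (a + 2 * b) := by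
      rw [K, hNE]; positivity
    have := pos_of_mul_pos_left this (by positivity)
    exact_mod_cast this
  obtain ⟨m0, m0'⟩ := two_pos u0 v0 K0 (by rw [← e1, ← e2]; nlinarith [mul_pos hE (mul_pos c0 (show 0 < 2 * b + a by positivity))])
  have KN : M * M' < N := by
    have : (M * M' : ℝ) < N := by
      by_contra hc
      push Not at hc
      have K0' : 0 < (M * M' : ℝ) := by exact_mod_cast K0
      nlinarith [mul_pos K0' b0]
    exact_mod_cast this
  have f1 : ((M':ℝ) - M) * (2 * a + b) = (M' + M) * c := by
    -- e1 * (X2) = e2 * X1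
    have h3 : 3 * a * b ≠ 0 := by positivity
    apply mul_left_cancel₀ h3
    linear_combination ((2 * b + a) * c + 3 * b * (a + b) - c^2) * e1 - (c^2 + (2 * b + a) * c - 3 * b * (a + b)) * e2 - M' * (c + 3 * b) * cc + M * (3 * b - c) * cc
  have f2 : 2 * (M * M') * b = (N - M * M') * a := by linear_combination K
  have f3 : 2 * ((M:ℝ) * M') * (2 * a + b) = a * (N + 3 * (M * M')) := by linear_combination f2
  have f4 : (2 * ((M:ℝ) * M'))^2 * c^2 = a^2 * (N^2 + 3 * (M * M')^2) := by
    linear_combination (2 * ((M:ℝ) * M'))^2 * cc + (2 * (M * M') * b + (N - M * M') * a + 2 * (M * M') * a) * f2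
  have f5 : ((M':ℝ) - M)^2 * (N + 3 * (M * M'))^2 = (M' + M)^2 * (N^2 + 3 * (M * M')^2) := by
    have h3 : a^2 ≠ 0 := by positivity
    apply mul_left_cancel₀ h3
    have g1 : a^2 * (((M':ℝ) - M)^2 * (N + 3 * (M * M'))^2) = (((M':ℝ) - M) * (2 * a + b))^2 * (2 * (M * M'))^2 := by
      rw [show a^2 * (((M':ℝ) - M)^2 * (N + 3 * (M * M'))^2) = (((M':ℝ) - M) * (a * (N + 3 * (M * M'))))^2 by ring, ← f3]; ring
    rw [g1, f1]
    linear_combination (M' + M : ℝ)^2 * f4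
  lift M to ℕ using m0.le
  lift M' to ℕ using m0'.le
  have hM : M ≤ N := by have := le_abs_self (M:ℤ); omega
  have hM' : M' ≤ N := by have := le_abs_self (M':ℤ); omega
  exact alg4_dec ⟨N, hN⟩ ⟨M, by omega⟩ ⟨M', by omega⟩ ⟨by exact_mod_cast KN, by dsimp only; omega, by dsimp only; omega, by dsimp only; omega, by dsimp only; omega⟩ (by exact_mod_cast f5)

lemma alg5 (h : Tile α β a b c) {N : ℕ} (hN : N < 12) {M M' : ℤ} {E : ℝ} (hE : 0 < E) (hM : |M| ≤ N) (hM' : |M'| ≤ N)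
    (pM : M % 2 = N % 2) (pM' : M' % 2 = N % 2)
    (e1 : E * (b * (2 * a + b) - b * c) = M * (c + a - b))
    (e2 : E * (b * (2 * a + b) + b * c) = M' * (c + b - a)) (hNE : N = E^2 * ((2 * a + b) * (a + b))) : False := by
  have u0 := h.u0
  have v0 := h.v0
  have uv := h.uv
  obtain ⟨a0, b0, c0, cc, ab, -⟩ := h
  have K : (M * M' : ℝ) = E^2 * (b * (a + b)) := by
    have h3 : 3 * (a * b) ≠ 0 := by positivity
    apply mul_left_cancel₀ h3
    rw [← uv]
    have : ((c + a - b) * (c + b - a)) * (M * M' : ℝ) = (M * (c + a - b)) * (M' * (c + b - a)) := by ring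
    rw [this, ← e1, ← e2, uv]
    linear_combination (-E^2 * b^2) * cc
  have K0 : 0 < M * M' := by
    have : 0 < (M * M' : ℝ) := by rw [K]; positivity
    exact_mod_cast this
  obtain ⟨m0, m0'⟩ := two_pos u0 v0 K0 (by rw [← e1, ← e2]; nlinarith [mul_pos hE (mul_pos b0 (show 0 < 2 * a + b by positivity))])
  have KN : M * M' < N := by
    have : (M * M' : ℝ) < N := by
      rw [K, hNE]
      nlinarith [mul_pos (pow_pos hE 2) (mul_pos a0 (show 0 < a + b by positivity))]
    exact_mod_cast this
  have f1 : ((M':ℝ) - M) * c = (M' + M) * a := by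
    have h3 : 3 * E * a * b ≠ 0 := by positivity
    apply mul_left_cancel₀ h3
    linear_combination E * b * (2 * a + b + c) * e1 - E * b * (2 * a + b - c) * e2 + E * b * (M + M') * cc
  have f2 : 2 * (M * M') * a = (N - M * M') * b := by rw [K, hNE]; ring
  have f4 : (N - (M:ℝ) * M')^2 * c^2 = a^2 * (N^2 + 3 * (M * M')^2) := by
    linear_combination (N - ((M:ℝ) * M'))^2 * cc - (2 * (M * M') * a + (N - M * M') * b + (N - M * M') * a) * f2
  have f5 : ((M':ℝ) - M)^2 * (N^2 + 3 * (M * M')^2) = (M' + M)^2 * (N - (M * M'))^2 := by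
    have h3 : a^2 ≠ 0 := by positivity
    apply mul_left_cancel₀ h3
    linear_combination (-((M':ℝ) - M)^2) * f4 + (N - M * M')^2 * (((M':ℝ) - M) * c + (M' + M) * a) * f1
  lift M to ℕ using m0.le
  lift M' to ℕ using m0'.le
  have hM : M ≤ N := by have := le_abs_self (M:ℤ); omega
  have hM' : M' ≤ N := by have := le_abs_self (M':ℤ); omega
  exact alg5_dec ⟨N, hN⟩ ⟨M, by omega⟩ ⟨M', by omega⟩ ⟨by exact_mod_cast KN, by dsimp only; omega, by dsimp only; omega, by dsimp only; omega, by dsimp only; omega⟩ (by exact_mod_cast f5)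

/-- sub-case c = 2(a-b) -/
lemma alg7_aux (a0 : 0 < a) (b0 : 0 < b) (cc : c^2 = a^2 + a*b + b^2) (hc : c = 2 * (a - b)) {E : ℝ}
    (e1 : 3 * (a * b) * E = c + a - b) {p q r : ℕ} (hL : E * (b * (2 * a + b)) = p * a + q * b + r * c) : False := by
  have f0 : a^2 - 3 * a * b + b^2 = 0 := by rw [hc] at cc; linear_combination cc / 3
  have f1 : E * (b * (2 * a + b)) = 3 * a - 4 * b := by
    apply mul_left_cancel₀ a0.ne'
    linear_combination (2 * a + b)/3 * e1 + (2 * a + b) / 3 * hc - f0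
  have f2 : ((p:ℝ) + 2 * r - 3) * a = (2 * r - 4 - q) * b := by
    rw [f1, hc] at hL; linear_combination -hL
  have f3 : ((p:ℤ) + 2 * r - 3)^2 * 5 = (2 * (2 * r - 4 - q) - 3 * (p + 2 * r - 3))^2 := by
    have : ((p:ℝ) + 2 * r - 3)^2 * 5 = (2 * (2 * r - 4 - q) - 3 * (p + 2 * r - 3))^2 := by
      have h3 : b^2 ≠ 0 := by positivity
      apply mul_left_cancel₀ h3
      linear_combination (-4 * ((p:ℝ) + 2 * r - 3)^2) * f0 + (4 * (((p:ℝ) + 2 * r - 3) * a + (2 * r - 4 - q) * b) - 12 * b * ((p:ℝ) + 2 * r - 3)) * f2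
    exact_mod_cast this
  have s := nonsq (by decide +kernel) f3
  have f4 : (2 * r - 4 - q : ℝ) * b = 0 := by
    have : (p:ℝ) + 2 * r - 3 = 0 := by exact_mod_cast s
    rw [← f2, this, zero_mul]
  have f5 : (2 * r - 4 - q : ℤ) = 0 := by
    have := (mul_eq_zero.1 f4).resolve_right b0.ne'
    exact_mod_cast this
  omega

lemma alg7 (h : Tile α β a b c) {N : ℕ} (hN : N < 12) {M M' : ℤ} {E : ℝ} (hE : 0 < E)
    (pM : M % 2 = N % 2) (pM' : M' % 2 = N % 2)
    (e1 : 3 * (a * b) * E = M * (c + a - b))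
    (e2 : 3 * (a * b) * E = M' * (c + b - a)) (hNE : N = E^2 * ((2 * b + a) * (2 * a + b)))
    {p q r p' q' r' : ℕ} (hL0 : E * (a * (2 * b + a)) = p * a + q * b + r * c)
    (hL1 : E * (b * (2 * a + b)) = p' * a + q' * b + r' * c) : False := by
  have u0 := h.u0
  have v0 := h.v0
  have uv := h.uv
  obtain ⟨a0, b0, c0, cc, ab, -⟩ := h
  have m0 : 0 < M := pos_int u0 (e1 ▸ by positivity)
  have m0' : 0 < M' := pos_int v0 (e2 ▸ by positivity)
  have K : (M * M' : ℝ) = 3 * (a * b) * E^2 := by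
    have h3 : 3 * (a * b) ≠ 0 := by positivity
    apply mul_left_cancel₀ h3
    linear_combination (-(M:ℝ) * M') * uv - (M' * (c + b - a)) * e1 - 3 * (a * b) * E * e2
  have KN : 3 * (M * M') < N := by
    have : (3 * (M * M') : ℝ) < N := by
      rw [K, hNE]
      have : 0 < (a - b)^2 := by have := sub_ne_zero.2 ab; positivity
      nlinarith [mul_pos (pow_pos hE 2) this]
    exact_mod_cast this
  have ne : M ≠ M' := by
    rintro rfl
    have : (M:ℝ) ≠ 0 := by exact_mod_cast m0.ne'
    apply ab
    have := mul_left_cancel₀ this (e1.symm.trans e2)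
    linarith
  have K3 : M * M' ≤ 3 := by omega
  have b1 : M ≤ 3 := by nlinarith
  have b2 : M' ≤ 3 := by nlinarith
  have cas : (M = 1 ∧ M' = 3) ∨ (M = 3 ∧ M' = 1) := by
    interval_cases M <;> interval_cases M' <;> omega
  rcases cas with ⟨rfl, rfl⟩ | ⟨rfl, rfl⟩
  · push_cast at e1 e2
    exact alg7_aux a0 b0 cc (by linarith) (by linarith) hL1
  · push_cast at e1 e2
    exact alg7_aux (a := b) (b := a) (c := c) (E := E) (p := q) (q := p) (r := r) b0 a0 (by rw [cc]; ring) (by linarith) (by linarith) (by linarith)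

end

end TT
end

section
namespace TT

section
variable {N : ℕ} {A T : Trc} {t : Fin N → Trc}

/-- shape: rows of corner counts -/
def Shp (A : Trc) (t : Fin N → Trc) (m n : Fin 3 → ℕ) : Prop :=
  ∀ i, cnt A t i 0 = m i ∧ cnt A t i 1 = n i ∧ cnt A t i 2 = 0

lemma CT.pack (H : CT N A T t) (hirr : ¬ ∃ q : ℚ, ang T 0 = (q : ℝ) * π) (hg : ang T 2 = 2 * π / 3)
    {m n : Fin 3 → ℕ} (hs : Shp A t m n) :
    ∃ α β a b c : ℝ, Tile α β a b c ∧ a = ‖ed T 0‖ ∧ b = ‖ed T 1‖ ∧ c = ‖ed T 2‖ ∧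
     ∃ D > 0, (∀ i, ‖ed A i‖ = D * xs c (m i * α + n i * β)) ∧
      N * (a * b * c) = D^2 * (xs c (m 0 * α + n 0 * β) * xs c (m 1 * α + n 1 * β) * xs c (m 2 * α + n 2 * β)) ∧
     (∃ M : ℤ, |M| ≤ N ∧ M % 2 = N % 2 ∧
      D * xs c (m 0 * α + n 0 * β) + sgn (n 2) * (D * xs c (m 1 * α + n 1 * β)) + sgn (n 2) * sgn (n 0) * (D * xs c (m 2 * α + n 2 * β))
        = M * (c + a - b)) ∧
     (∃ M : ℤ, |M| ≤ N ∧ M % 2 = N % 2 ∧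
      D * xs c (m 0 * α + n 0 * β) + sgn (m 2) * (D * xs c (m 1 * α + n 1 * β)) + sgn (m 2) * sgn (m 0) * (D * xs c (m 2 * α + n 2 * β))
        = M * (c + b - a)) := by
  have hT := tile_of T H.hT hirr hg
  obtain ⟨D, D0, h1, h2⟩ := H.sines hirr hg
  have ha : ∀ i, ang A i = m i * ang T 0 + n i * ang T 1 := by
    intro i
    obtain ⟨e0, e1, e2⟩ := hs i
    rw [H.corner i, Fin.sum_univ_three, e0, e1, e2]; simp
  obtain ⟨M, a1, a2, a3⟩ := H.p1 hirr hg (fun i => (hs i).2.2)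
  obtain ⟨M', b1, b2, b3⟩ := H.p2 hirr hg (fun i => (hs i).2.2)
  simp only [ha] at h1 h2
  simp only [(hs _).1, (hs _).2.1, h1] at a3 b3
  exact ⟨_, _, _, _, _, hT, rfl, rfl, rfl, D, D0, h1, h2, ⟨M, a1, a2, a3⟩, ⟨M', b1, b2, b3⟩⟩

lemma CT.shape2 (H : CT N A T t) (hirr : ¬ ∃ q : ℚ, ang T 0 = (q : ℝ) * π) (hg : ang T 2 = 2 * π / 3)
    (hs : Shp A t ![1,1,1] ![0,0,3]) : 12 ≤ N := by
  obtain ⟨α, β, a, b, c, hT, -, -, -, D, D0, -, h2, ⟨M, a1, a2, a3⟩, ⟨M', b1, b2, b3⟩⟩ := H.pack hirr hg hs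
  simp [sgn, hT.x_a, hT.x_a3b] at h2 a3 b3
  have c0 := hT.c0
  have a0 := hT.a0
  refine alg2 (E := D * a / c) hT (by positivity) b1 (M := M) ?_ ?_
  · rw [← a3]; field_simp; ring
  · rw [← b3]; field_simp; ring

lemma CT.shapeE (H : CT N A T t) (hirr : ¬ ∃ q : ℚ, ang T 0 = (q : ℝ) * π) (hg : ang T 2 = 2 * π / 3)
    (hs : Shp A t ![1,1,1] ![1,1,1]) : 12 ≤ N := by
  obtain ⟨α, β, a, b, c, hT, ra, rb, rc, D, D0, h1, h2, ⟨M, a1, a2, a3⟩, ⟨M', b1, b2, b3⟩⟩ := H.pack hirr hg hs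
  obtain ⟨p, p1, -⟩ := H.comb 0
  rw [h1 0, ← ra, ← rb, ← rc] at p1
  simp [sgn, hT.x_ab] at h2 a3 b3 p1
  have c0 := hT.c0
  by_contra hN
  push Not at hN
  refine algE (X := D * c) hT hN (by positivity) a1 b1 a2 b2 ?_ ?_ ?_ p1
  · rw [← a3]; ring
  · rw [← b3]; ring
  · apply mul_right_cancel₀ c0.ne'; linear_combination h2

lemma CT.shape4 (H : CT N A T t) (hirr : ¬ ∃ q : ℚ, ang T 0 = (q : ℝ) * π) (hg : ang T 2 = 2 * π / 3)
    (hs : Shp A t ![1,2,0] ![0,0,3]) : 12 ≤ N := by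
  obtain ⟨α, β, a, b, c, hT, ra, rb, rc, D, D0, h1, h2, ⟨M, a1, a2, a3⟩, ⟨M', b1, b2, b3⟩⟩ := H.pack hirr hg hs
  simp [sgn, hT.x_a, hT.x_2a, hT.x_3b] at h2 a3 b3
  have c0 := hT.c0
  have a0 := hT.a0
  have b0 := hT.b0
  by_contra hN
  push Not at hN
  refine alg4 (E := D * a / c^2) (M := M) (M' := -M') hT hN (by positivity) a1 (by rwa [abs_neg]) a2 (by omega) ?_ ?_ ?_
  · rw [← a3]; field_simp; ring
  · push_cast; rw [neg_mul, ← b3]; field_simp; ring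
  · have : (a * b * c) ≠ 0 := by positivity
    apply mul_right_cancel₀ this; rw [h2]; field_simp

lemma CT.shape5 (H : CT N A T t) (hirr : ¬ ∃ q : ℚ, ang T 0 = (q : ℝ) * π) (hg : ang T 2 = 2 * π / 3)
    (hs : Shp A t ![1,2,0] ![0,1,2]) : 12 ≤ N := by
  obtain ⟨α, β, a, b, c, hT, ra, rb, rc, D, D0, h1, h2, ⟨M, a1, a2, a3⟩, ⟨M', b1, b2, b3⟩⟩ := H.pack hirr hg hs
  simp [sgn, hT.x_a, hT.x_2ab, hT.swap.x_2a] at h2 a3 b3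
  have c0 := hT.c0
  have a0 := hT.a0
  have b0 := hT.b0
  by_contra hN
  push Not at hN
  refine alg5 (E := D / c) (M := M) (M' := -M') hT hN (by positivity) a1 (by rwa [abs_neg]) a2 (by omega) ?_ ?_ ?_
  · rw [← a3]; field_simp; ring
  · push_cast; rw [neg_mul, ← b3]; field_simp; ring
  · have : (a * b * c) ≠ 0 := by positivity
    apply mul_right_cancel₀ this; rw [h2]; field_simp

lemma CT.shape7 (H : CT N A T t) (hirr : ¬ ∃ q : ℚ, ang T 0 = (q : ℝ) * π) (hg : ang T 2 = 2 * π / 3)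
    (hs : Shp A t ![2,0,1] ![0,2,1]) : 12 ≤ N := by
  obtain ⟨α, β, a, b, c, hT, ra, rb, rc, D, D0, h1, h2, ⟨M, a1, a2, a3⟩, ⟨M', b1, b2, b3⟩⟩ := H.pack hirr hg hs
  obtain ⟨p, p1, -⟩ := H.comb 0
  obtain ⟨q, q1, -⟩ := H.comb 1
  rw [h1 0, ← ra, ← rb, ← rc] at p1
  rw [h1 1, ← ra, ← rb, ← rc] at q1
  simp [sgn, hT.x_ab, hT.x_2a, hT.swap.x_2a] at h2 a3 b3 p1 q1
  have c0 := hT.c0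
  have a0 := hT.a0
  have b0 := hT.b0
  by_contra hN
  push Not at hN
  refine alg7 (E := D / c) hT hN (by positivity) a2 b2 ?_ ?_ ?_ (p1.symm.trans (by field_simp)).symm (q1.symm.trans (by field_simp)).symm
  · rw [← a3]; field_simp; linear_combination hT.cc
  · rw [← b3]; field_simp; linear_combination hT.cc
  · have : (a * b * c) ≠ 0 := by positivity
    apply mul_right_cancel₀ this; rw [h2]; field_simp

lemma CT.shape3 (H : CT N A T t) (hirr : ¬ ∃ q : ℚ, ang T 0 = (q : ℝ) * π) (hg : ang T 2 = 2 * π / 3)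
    (hs : Shp A t ![1,1,1] ![0,1,2]) : 12 ≤ N := by
  obtain ⟨α, β, a, b, c, hT, ra, rb, rc, D, D0, h1, h2, ⟨M, a1, a2, a3⟩, ⟨M', b1, b2, b3⟩⟩ := H.pack hirr hg hs
  obtain ⟨p, p1, p2⟩ := H.comb 0
  obtain ⟨q, q1, q2⟩ := H.comb 1
  rw [h1 0, ← ra, ← rb, ← rc] at p1
  rw [h1 1, ← ra, ← rb, ← rc] at q1
  simp [sgn, hT.x_a, hT.x_ab, hT.x_a2b] at h2 a3 b3 p1 q1
  have c0 := hT.c0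
  have a0 := hT.a0
  have b0 := hT.b0
  by_contra hN
  push Not at hN
  have key := fun x y z => alg3 (D := D) (p := x) (q := y) (r := z) hT hN D0 a1 b1 a2 b2 (by rw [← a3]; ring) (by rw [← b3]; ring)
    (by have : a * c ≠ 0 := by positivity
        apply mul_right_cancel₀ this; linear_combination h2)
  have kp := key _ _ _ (Or.inr p1)
  have kq := key _ _ _ (Or.inl q1)
  have i1 : ∀ (r : Fin 3 → ℕ) (i : Fin 3), r 0 = 0 ∧ r 2 = 0 → r i ≠ 0 → i = 1 := by
    intro r i h1 h2
    fin_cases i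
    · exact absurd h1.1 h2
    · rfl
    · exact absurd h1.2 h2
  -- corner 2
  have main : ∀ k : Fin 3, (∀ x, onS A t k x → x.2 = 1) → (2 = k + 1 ∨ 2 = k + 2) →
      ∃ j, t j 0 = A 2 ∧ bc A k (t j 2) = 0 := by
    intro k hk he
    obtain ⟨⟨j, i⟩, hon, hj⟩ := H.toTil.side_corner k he
    obtain rfl : i = 1 := hk _ hon
    refine ⟨j, ?_, hon.1⟩
    rcases hj with hj | hj
    · exfalso
      have h0 := (hs 2).2.2
      classical
      rw [cnt, Finset.card_eq_zero] at h0
      have : j ∈ Finset.univ.filter (fun j => t j 2 = A 2) := by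
        rw [Finset.mem_filter]; exact ⟨Finset.mem_univ _, hj.symm⟩
      convert h0 ▸ this
      simp
    · exact hj.symm
  obtain ⟨j, j1, j2⟩ := main 0 (fun x hx => i1 p _ kp (p2 x hx)) (Or.inr rfl)
  obtain ⟨l, l1, l2⟩ := main 1 (fun x hx => i1 q _ kq (q2 x hx)) (Or.inl rfl)
  have hjl : j = l := by
    have h0 := (hs 2).1
    simp [cnt] at h0
    rw [Finset.card_eq_one] at h0
    obtain ⟨w, hw⟩ := h0
    have e1 : j ∈ ({w} : Finset (Fin N)) := by rw [← hw]; simpa using j1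
    have e2 : l ∈ ({w} : Finset (Fin N)) := by rw [← hw]; simpa using l1
    rw [Finset.mem_singleton] at e1 e2
    rw [e1, e2]
  subst hjl
  have : t j 2 = A 2 := by
    have r := bc_rep A H.hA (t j 2)
    have s := bc_sum A H.hA (t j 2)
    rw [j2, l2] at r s
    rw [r]
    have : bc A 2 (t j 2) = 1 := by linarith
    simp [this]
  have := vert_inj (t j) (H.ht j) (this.trans j1.symm)
  exact absurd this (by decide)

end

end TT
end

section
namespace TT

section
variable {N : ℕ} {A T : Trc} {t : Fin N → Trc}

set_option synthInstance.maxSize 5000 in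
set_option synthInstance.maxHeartbeats 400000 in
lemma fin3_perm : ∀ i j k : Fin 3, i ≠ j ∧ j ≠ k ∧ i ≠ k → (i = 0 ∧ j = 1 ∧ k = 2) ∨ (i = 0 ∧ j = 2 ∧ k = 1) ∨
   (i = 1 ∧ j = 0 ∧ k = 2) ∨ (i = 1 ∧ j = 2 ∧ k = 0) ∨ (i = 2 ∧ j = 0 ∧ k = 1) ∨ (i = 2 ∧ j = 1 ∧ k = 0) := by decide

lemma dt_comp (t : Trc) (h : dt t ≠ 0) (σ : Equiv.Perm (Fin 3)) : dt (t ∘ σ) ≠ 0 := by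
  have : dt (t ∘ σ) = dt t ∨ dt (t ∘ σ) = - dt t := by
    simp only [dt, Function.comp]
    rcases fin3_perm (σ 0) (σ 1) (σ 2) ⟨by simp, by simp, by simp⟩ with ⟨a, b, c⟩ | ⟨a, b, c⟩ | ⟨a, b, c⟩ | ⟨a, b, c⟩ | ⟨a, b, c⟩ | ⟨a, b, c⟩ <;>
    rw [a, b, c] <;> simp only [cr, Complex.sub_re, Complex.sub_im]
    · left; trivial
    · right; ring
    · right; ring
    · left; ring
    · left; ring
    · right; ring
  rcases this with e | e <;> rw [e]
  · exact h
  · exact neg_ne_zero.2 h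

lemma hull_comp (t : Trc) (σ : Equiv.Perm (Fin 3)) : hull (t ∘ σ) = hull t := by
  rw [hull, hull, EquivLike.range_comp]

lemma CT.permA (H : CT N A T t) (σ : Equiv.Perm (Fin 3)) : CT N (A ∘ σ) T t where
  hA := dt_comp A H.hA σ
  ht := H.ht
  disj := H.disj
  cover := by rw [hull_comp]; exact H.cover
  hT := H.hT
  cong := H.cong

lemma CT.permT (H : CT N A T t) (σ : Equiv.Perm (Fin 3)) : CT N A (T ∘ σ) (fun j => t j ∘ σ) where
  hA := H.hA
  ht := fun j => dt_comp _ (H.ht j) σ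
  disj := by simp only [hull_comp]; exact H.disj
  cover := by simp only [hull_comp]; exact H.cover
  hT := dt_comp T H.hT σ
  cong := fun j i k => H.cong j _ _

lemma exists_perm (i j k : Fin 3) (h : i ≠ j ∧ j ≠ k ∧ i ≠ k) : ∃ σ : Equiv.Perm (Fin 3), σ 0 = i ∧ σ 1 = j ∧ σ 2 = k := by
  have : Function.Injective ![i, j, k] := by
    intro x y
    obtain ⟨h1, h2, h3⟩ := h
    fin_cases x <;> fin_cases y <;> simp [h1, h2, h3, h1.symm, h2.symm, h3.symm]
  exact ⟨Equiv.ofBijective _ (Finite.injective_iff_bijective.1 this), rfl, rfl, rfl⟩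

lemma irr_swap (h : dt T ≠ 0) (hirr : ¬ ∃ q : ℚ, ang T 0 = (q : ℝ) * π) (hg : ang T 2 = 2 * π / 3) :
    ¬ ∃ q : ℚ, ang T 1 = (q : ℝ) * π := by
  rintro ⟨q, hq⟩
  have := (tile_of T h hirr hg).sum
  exact hirr ⟨1/3 - q, by push_cast; linarith⟩

def Can (m n : Fin 3 → ℕ) : Prop :=
  (m = ![1,1,1] ∧ n = ![0,0,3]) ∨ (m = ![1,1,1] ∧ n = ![1,1,1]) ∨ (m = ![1,2,0] ∧ n = ![0,0,3]) ∨
  (m = ![1,2,0] ∧ n = ![0,1,2]) ∨ (m = ![2,0,1] ∧ n = ![0,2,1]) ∨ (m = ![1,1,1] ∧ n = ![0,1,2])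

lemma CT.can (H : CT N A T t) (hirr : ¬ ∃ q : ℚ, ang T 0 = (q : ℝ) * π) (hg : ang T 2 = 2 * π / 3) {m n : Fin 3 → ℕ}
    (hs : Shp A t m n) (hc : Can m n) : 12 ≤ N := by
  rcases hc with ⟨rfl, rfl⟩ | ⟨rfl, rfl⟩ | ⟨rfl, rfl⟩ | ⟨rfl, rfl⟩ | ⟨rfl, rfl⟩ | ⟨rfl, rfl⟩
  · exact H.shape2 hirr hg hs
  · exact H.shapeE hirr hg hs
  · exact H.shape4 hirr hg hs
  · exact H.shape5 hirr hg hs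
  · exact H.shape7 hirr hg hs
  · exact H.shape3 hirr hg hs

lemma CT.can_swap (H : CT N A T t) (hirr : ¬ ∃ q : ℚ, ang T 0 = (q : ℝ) * π) (hg : ang T 2 = 2 * π / 3) {m n : Fin 3 → ℕ}
    (hs : Shp A t m n) (hc : Can n m) : 12 ≤ N := by
  have H' := H.permT (Equiv.swap 0 1)
  have s0 : (Equiv.swap 0 1 : Equiv.Perm (Fin 3)) 0 = 1 := by decide
  have s1 : (Equiv.swap 0 1 : Equiv.Perm (Fin 3)) 1 = 0 := by decide
  have s2 : (Equiv.swap 0 1 : Equiv.Perm (Fin 3)) 2 = 2 := by decide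
  have e0 : ang (T ∘ (Equiv.swap 0 1 : Equiv.Perm (Fin 3))) 0 = ang T 1 := by
    rw [ang, ang, InnerProductGeometry.angle_comm]
    simp only [Function.comp, zero_add, s0, s1, s2]; rfl
  have e2 : ang (T ∘ (Equiv.swap 0 1 : Equiv.Perm (Fin 3))) 2 = ang T 2 := by
    rw [ang, ang, InnerProductGeometry.angle_comm]
    have : (2 : Fin 3) + 1 = 0 := rfl
    have : (2 : Fin 3) + 2 = 1 := rfl
    simp only [Function.comp, *]
  refine H'.can (by rw [e0]; exact irr_swap H.hT hirr hg) (by rw [e2]; exact hg) (m := n) (n := m) ?_ hc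
  intro i
  obtain ⟨a, b, c⟩ := hs i
  refine ⟨?_, ?_, ?_⟩
  · rw [← b]; simp only [cnt, Function.comp, s0]
  · rw [← a]; simp only [cnt, Function.comp, s1]
  · rw [← c]; simp only [cnt, Function.comp, s2]

lemma CT.sim (H : CT N A T t) (hirr : ¬ ∃ q : ℚ, ang T 0 = (q : ℝ) * π) (hg : ang T 2 = 2 * π / 3)
    (h : ∀ i, ang A i = ang T i) : ∃ r > 0, ∀ i j, dist (T i) (T j) = r * dist (A i) (A j) := by
  have hT := tile_of T H.hT hirr hg
  obtain ⟨D, D0, h1, -⟩ := H.sines hirr hg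
  have h2 : ∀ i, xs ‖ed T 2‖ (ang T i) = ‖ed T i‖ := by
    intro i
    fin_cases i
    · exact hT.x_a
    · exact hT.swap.x_a
    · show xs ‖ed T 2‖ (ang T 2) = ‖ed T 2‖
      refine Eq.trans ?_ hT.x_ab
      rw [xs, xs, hT.sum, hg, show 2 * π / 3 = π - π / 3 by ring, Real.sin_pi_sub]
  have h3 : ∀ i, ‖ed T i‖ = D⁻¹ * ‖ed A i‖ := by
    intro i
    rw [h1 i, h i, h2 i]; field_simp
  refine ⟨D⁻¹, by positivity, ?_⟩
  have k0 : dist (T 2) (T 1) = D⁻¹ * dist (A 2) (A 1) := by rw [dist_eq_norm, dist_eq_norm]; exact h3 0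
  have k1 : dist (T 0) (T 2) = D⁻¹ * dist (A 0) (A 2) := by rw [dist_eq_norm, dist_eq_norm]; exact h3 1
  have k2 : dist (T 1) (T 0) = D⁻¹ * dist (A 1) (A 0) := by rw [dist_eq_norm, dist_eq_norm]; exact h3 2
  intro i j
  fin_cases i <;> fin_cases j <;> simp only [Fin.zero_eta, Fin.mk_one, Fin.reduceFinMk, dist_self, mul_zero]
  · rw [dist_comm, k2, dist_comm]
  · exact k1
  · exact k2
  · rw [dist_comm, k0, dist_comm]
  · rw [dist_comm, k1, dist_comm]
  · exact k0

instance (m n : Fin 3 → ℕ) : Decidable (Can m n) := by unfold Can; infer_instance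

def Res (m n : Fin 3 → ℕ) : Prop := (m = ![1,0,2] ∧ n = ![0,1,2]) ∨ Can m n ∨ Can n m

instance (m n : Fin 3 → ℕ) : Decidable (Res m n) := by unfold Res; infer_instance

def fn (x y z : ℕ) : Fin 3 → ℕ := ![x, y, z]

lemma enum1 : ∀ m0 m1 m2 n0 n1 n2 : Fin 4, (m0.1 + m1.1 + m2.1 = 3 ∧ n0.1 + n1.1 + n2.1 = 3) ∧
    (m0.1 + n0.1 ≠ 0 ∧ m1.1 + n1.1 ≠ 0 ∧ m2.1 + n2.1 ≠ 0) →
    ∃ i j k : Fin 3, (i ≠ j ∧ j ≠ k ∧ i ≠ k) ∧ Res (fn m0.1 m1.1 m2.1 ∘ ![i, j, k]) (fn n0.1 n1.1 n2.1 ∘ ![i, j, k]) := by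
  decide +kernel

lemma enum2 : ∀ a0 a1 a2 b0 b1 b2 c0 c1 c2 : Fin 2,
    (a0.1 + a1.1 + a2.1 = 1 ∧ b0.1 + b1.1 + b2.1 = 1 ∧ c0.1 + c1.1 + c2.1 = 1) ∧
    (a0.1 + b0.1 + c0.1 ≠ 0 ∧ a1.1 + b1.1 + c1.1 ≠ 0 ∧ a2.1 + b2.1 + c2.1 ≠ 0) →
    ∃ i j k : Fin 3, (i ≠ j ∧ j ≠ k ∧ i ≠ k) ∧ fn a0.1 a1.1 a2.1 ∘ ![i, j, k] = ![1, 0, 0] ∧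
       fn b0.1 b1.1 b2.1 ∘ ![i, j, k] = ![0, 1, 0] ∧ fn c0.1 c1.1 c2.1 ∘ ![i, j, k] = ![0, 0, 1] := by
  decide +kernel

lemma fn_eta (f : Fin 3 → ℕ) : fn (f 0) (f 1) (f 2) = f := by
  ext i; fin_cases i <;> rfl

lemma perm_eta {σ : Equiv.Perm (Fin 3)} {i j k : Fin 3} (h : σ 0 = i ∧ σ 1 = j ∧ σ 2 = k) : ![i, j, k] = σ := by
  obtain ⟨rfl, rfl, rfl⟩ := h
  ext i; fin_cases i <;> rfl

lemma enum1' (m n : Fin 3 → ℕ) (hm : m 0 + m 1 + m 2 = 3) (hn : n 0 + n 1 + n 2 = 3) (h : ∀ i, m i + n i ≠ 0) :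
    ∃ σ : Equiv.Perm (Fin 3), Res (m ∘ σ) (n ∘ σ) := by
  obtain ⟨i, j, k, h1, h2⟩ := enum1 ⟨m 0, by omega⟩ ⟨m 1, by omega⟩ ⟨m 2, by omega⟩ ⟨n 0, by omega⟩ ⟨n 1, by omega⟩ ⟨n 2, by omega⟩
    ⟨⟨hm, hn⟩, h 0, h 1, h 2⟩
  obtain ⟨σ, hσ⟩ := exists_perm i j k h1
  rw [perm_eta hσ, fn_eta m, fn_eta n] at h2
  exact ⟨σ, h2⟩

lemma enum2' (a b c : Fin 3 → ℕ) (ha : a 0 + a 1 + a 2 = 1) (hb : b 0 + b 1 + b 2 = 1) (hc : c 0 + c 1 + c 2 = 1)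
    (h : ∀ i, a i + b i + c i ≠ 0) :
    ∃ σ : Equiv.Perm (Fin 3), a ∘ σ = ![1,0,0] ∧ b ∘ σ = ![0,1,0] ∧ c ∘ σ = ![0,0,1] := by
  obtain ⟨i, j, k, h1, h2⟩ := enum2 ⟨a 0, by omega⟩ ⟨a 1, by omega⟩ ⟨a 2, by omega⟩ ⟨b 0, by omega⟩ ⟨b 1, by omega⟩ ⟨b 2, by omega⟩
    ⟨c 0, by omega⟩ ⟨c 1, by omega⟩ ⟨c 2, by omega⟩ ⟨⟨ha, hb, hc⟩, h 0, h 1, h 2⟩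
  obtain ⟨σ, hσ⟩ := exists_perm i j k h1
  rw [perm_eta hσ, fn_eta a, fn_eta b, fn_eta c] at h2
  exact ⟨σ, h2⟩

theorem CT.main (H : CT N A T t) (hirr : ¬ ∃ q : ℚ, ang T 0 = (q : ℝ) * π) (hg : ang T 2 = 2 * π / 3)
    (hns : ¬ ∃ r > 0, ∃ σ : Equiv.Perm (Fin 3), ∀ i j, dist (T i) (T j) = r * dist (A (σ i)) (A (σ j))) : 12 ≤ N := by
  have nosim : ∀ σ : Equiv.Perm (Fin 3), ¬ ∀ i, ang (A ∘ σ) i = ang T i := by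
    intro σ h
    obtain ⟨r, r0, hr⟩ := (H.permA σ).sim hirr hg h
    exact hns ⟨r, r0, σ, hr⟩
  have hT := tile_of T H.hT hirr hg
  obtain ⟨t1, t0⟩ := H.totals hirr hg
  simp only [Fin.sum_univ_three] at t0 t1
  have hr := H.row_ne
  by_cases z : cnt A t 0 2 + cnt A t 1 2 + cnt A t 2 2 = 0
  · have z' : ∀ i, cnt A t i 2 = 0 := by
      intro i; fin_cases i
      · show cnt A t 0 2 = 0
        omega
      · show cnt A t 1 2 = 0
        omega
      · show cnt A t 2 2 = 0
        omega
    obtain ⟨σ, hσ⟩ := enum1' (fun i => cnt A t i 0) (fun i => cnt A t i 1) (by omega) (by omega)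
      (fun i => by have := hr i; have := z' i; omega)
    have H' := H.permA σ
    have hs : Shp (A ∘ σ) t ((fun i => cnt A t i 0) ∘ σ) ((fun i => cnt A t i 1) ∘ σ) := fun i => ⟨rfl, rfl, z' (σ i)⟩
    rcases hσ with ⟨e1, e2⟩ | h | h
    · exfalso
      apply nosim σ
      intro i
      rw [e1, e2] at hs
      rw [H'.corner i, Fin.sum_univ_three, (hs i).1, (hs i).2.1, (hs i).2.2]
      fin_cases i
      · simp
      · simp
      · simp
        linarith [hT.sum]
    · exact H'.can hirr hg hs h
    · exact H'.can_swap hirr hg hs h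
  · exfalso
    obtain ⟨σ, e0, e1, e2⟩ := enum2' (fun i => cnt A t i 0) (fun i => cnt A t i 1) (fun i => cnt A t i 2) (by omega) (by omega) (by omega) hr
    apply nosim σ
    have H' := H.permA σ
    intro i
    have f0 := congrFun e0 i
    have f1 := congrFun e1 i
    have f2 := congrFun e2 i
    change cnt (A ∘ σ) t i 0 = _ at f0
    change cnt (A ∘ σ) t i 1 = _ at f1
    change cnt (A ∘ σ) t i 2 = _ at f2
    rw [H'.corner i, Fin.sum_univ_three, f0, f1, f2]
    fin_cases i <;> simp

end

end TT
end


namespace TT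

section

def ph : ℂ ≃ₗᵢ[ℝ] Pt := Complex.orthonormalBasisOneI.repr

def cx (T : Tri) : Trc := fun i => ph.symm (T i)

lemma cx_dist (T : Tri) (i k : Fin 3) : dist (cx T i) (cx T k) = dist (T i) (T k) := ph.symm.dist_map _ _

lemma cx_ang (T : Tri) (i : Fin 3) : ang (cx T) i = triAngle T i := by
  rw [ang, triAngle, EuclideanGeometry.angle]
  simp only [cx, ← map_sub]
  exact LinearIsometry.angle_map ph.symm.toLinearIsometry _ _

lemma cx_hull (T : Tri) : hull (cx T) = ph ⁻¹' (triSet T) := by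
  have h1 : cx T = ph.symm ∘ T := rfl
  have h2 : ph ⁻¹' (triSet T) = ph.symm '' (triSet T) := by
    ext x
    simp only [Set.mem_preimage, Set.mem_image]
    constructor
    · intro h; exact ⟨_, h, by simp⟩
    · rintro ⟨y, hy, rfl⟩; simpa using hy
  rw [h2, hull, h1, Set.range_comp, triSet]
  exact (LinearMap.image_convexHull ph.symm.toLinearEquiv.toLinearMap _).symm

lemma cx_int (T : Tri) : interior (hull (cx T)) = ph ⁻¹' (interior (triSet T)) := by
  rw [cx_hull]
  exact (ph.toHomeomorph.preimage_interior _).symm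

lemma dt_of (T : Tri) (h : IsTriangle T) : dt (cx T) ≠ 0 := by
  intro hd
  have h1 : AffineIndependent ℝ (cx T) := by
    have := (ph.symm.toLinearEquiv.toLinearMap.toAffineMap)
    exact AffineIndependent.map' h ph.symm.toLinearEquiv.toLinearMap.toAffineMap ph.symm.injective
  rw [affineIndependent_iff_not_collinear] at h1
  apply h1
  rw [collinear_iff_of_mem (p₀ := cx T 0) (Set.mem_range_self 0)]
  set s := cx T
  by_cases h0 : s 1 - s 0 = 0
  · refine ⟨s 2 - s 0, ?_⟩
    rintro p ⟨i, rfl⟩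
    fin_cases i
    · exact ⟨0, by simp⟩
    · exact ⟨0, by simpa using sub_eq_zero.1 h0⟩
    · exact ⟨1, by simp⟩
  · refine ⟨s 1 - s 0, ?_⟩
    rintro p ⟨i, rfl⟩
    fin_cases i
    · exact ⟨0, by simp⟩
    · exact ⟨1, by simp⟩
    · refine ⟨((s 2 - s 0) / (s 1 - s 0)).re, ?_⟩
      have hi : ((s 2 - s 0) / (s 1 - s 0)).im = 0 := by
        rw [Complex.div_im]
        simp only [dt, cr] at hd
        rw [← sub_div]
        rw [div_eq_zero_iff]
        left
        linarith
      have : (s 2 - s 0) = (((s 2 - s 0) / (s 1 - s 0)).re : ℂ) * (s 1 - s 0) := by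
        have e : (((s 2 - s 0) / (s 1 - s 0)).re : ℂ) = (s 2 - s 0) / (s 1 - s 0) := by
          apply Complex.ext <;> simp [hi]
        rw [e]; field_simp
      show s 2 = _
      rw [vadd_eq_add, Complex.real_smul, ← this]; ring

end

end TT

/-- If triangle `ABC` is `N`-tiled by a tile with angles `(α, β, 2π/3)` not
similar to `ABC`, and `α` is not a rational multiple of `π`, then `N ≥ 12`;
in particular `N` is not `7` and not `11`. -/
theorem twelve_le_of_tiling_gamma_two_pi_div_three (N : ℕ) (ABC T : Tri)
    (hABC : IsTriangle ABC) (hT : IsTriangle T)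
    (α β γ : ℝ) (hangles : HasAngles T α β γ)
    (hγ : γ = 2 * π / 3)
    (tiles : Fin N → Tri) (ht : IsTiling N ABC T tiles)
    (hsim : ¬ SimilarTri T ABC)
    (hirr : ¬ ∃ q : ℚ, α = (q : ℝ) * π) :
    12 ≤ N ∧ N ≠ 7 ∧ N ≠ 11 := by
  obtain ⟨rfl, rfl, rfl⟩ := hangles
  choose σ hσ using ht.congr
  have hc : ∀ j i k, dist ((TT.cx (tiles j) ∘ (σ j).symm) i) ((TT.cx (tiles j) ∘ (σ j).symm) k) = dist (TT.cx T i) (TT.cx T k) := by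
    intro j i k
    simp only [Function.comp, TT.cx_dist]
    rw [hσ j]; simp
  have he : ∀ j i, ‖TT.ed (TT.cx (tiles j) ∘ (σ j).symm) i‖ = ‖TT.ed (TT.cx T) i‖ := by
    intro j i
    rw [TT.ed, TT.ed, ← dist_eq_norm, ← dist_eq_norm, hc]
  have hT' := TT.dt_of T hT
  have H : TT.CT N (TT.cx ABC) (TT.cx T) (fun j => TT.cx (tiles j) ∘ (σ j).symm) := {
    hA := TT.dt_of ABC hABC
    hT := hT'
    cong := hc
    ht := by
      intro j h0
      have h1 := TT.heron (TT.cx (tiles j) ∘ (σ j).symm)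
      rw [he, he, he, ← TT.heron, h0] at h1
      apply hT'
      have : TT.dt (TT.cx T) ^ 2 = 0 := by linarith
      exact pow_eq_zero_iff (by norm_num) |>.1 this
    disj := by
      intro j l hjl x h1 h2
      rw [TT.hull_comp, TT.cx_int] at h1 h2
      have : TT.ph x ∈ interior (triSet (tiles j)) ∩ interior (triSet (tiles l)) := ⟨h1, h2⟩
      rw [ht.disj j l hjl] at this
      exact this
    cover := by
      intro x
      simp only [TT.hull_comp, TT.cx_hull, Set.mem_preimage]
      rw [← ht.cover, Set.mem_iUnion] }
  have h12 : 12 ≤ N := by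
    apply H.main
    · rw [TT.cx_ang]; exact hirr
    · rw [TT.cx_ang]; exact hγ
    · rintro ⟨r, r0, τ, h⟩
      apply hsim
      refine ⟨r, r0, τ, fun i j => ?_⟩
      have := h i j
      simpa only [TT.cx_dist] using this
  exact ⟨h12, by omega, by omega⟩
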